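/- arXiv:1907.11802 — 2 statements merged into one kernel-verified Lean document; each statement's English description precedes it below -/
import Mathlib

section
/- Let (W,S) be a finite Coxeter system and R its family of R-polynomials. If [u,w] is a dihedral Bruhat interval with ℓ(u,w) = n (that is: for all x, y ∈ [u,w], x ≤ y holds if and only if x = y or ℓ(x) < ℓ(y), and for every integer i with 0 < i < n there are exactly two elements v ∈ [u,w] with ℓ(v) = ℓ(u) + i), then R_{u,w}(q+1) = d_n(q), the n-th dihedral polynomial. -/
open Polynomial

/-- A Bruhat edge `u → v`: `v = u * t` for some reflection `t`, and `ℓ(u) < ℓ(v)`. -/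
def BruhatEdge {B W : Type*} [Group W] {M : CoxeterMatrix B}
    (cs : CoxeterSystem M W) (u v : W) : Prop :=
  ∃ t : W, cs.IsReflection t ∧ v = u * t ∧ cs.length u < cs.length v

/-- Bruhat order: the reflexive-transitive closure of the Bruhat edge relation. -/
def BruhatLE {B W : Type*} [Group W] {M : CoxeterMatrix B}
    (cs : CoxeterSystem M W) : W → W → Prop :=
  Relation.ReflTransGen (BruhatEdge cs)

/-- The defining properties of the family of `R`-polynomials. -/
def IsRFamily {B W : Type*} [Group W] {M : CoxeterMatrix B}
    (cs : CoxeterSystem M W) (R : W → W → Polynomial ℤ) : Prop :=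
  (∀ u w, ¬ BruhatLE cs u w → R u w = 0) ∧
  (∀ w, R w w = 1) ∧
  (∀ u w, ∀ i : B, cs.length (w * cs.simple i) < cs.length w →
    (cs.length (u * cs.simple i) < cs.length u →
      R u w = R (u * cs.simple i) (w * cs.simple i)) ∧
    (cs.length u < cs.length (u * cs.simple i) →
      R u w = (X - 1) * R u (w * cs.simple i)
        + X * R (u * cs.simple i) (w * cs.simple i)))

/-- The defining properties of the family of `R̃`-polynomials. -/
def IsRTildeFamily {B W : Type*} [Group W] {M : CoxeterMatrix B}
    (cs : CoxeterSystem M W) (Rt : W → W → Polynomial ℕ) : Prop :=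
  (∀ u w, ¬ BruhatLE cs u w → Rt u w = 0) ∧
  (∀ w, Rt w w = 1) ∧
  (∀ u w, ∀ i : B, cs.length (w * cs.simple i) < cs.length w →
    (cs.length (u * cs.simple i) < cs.length u →
      Rt u w = Rt (u * cs.simple i) (w * cs.simple i)) ∧
    (cs.length u < cs.length (u * cs.simple i) →
      Rt u w = X * Rt u (w * cs.simple i)
        + Rt (u * cs.simple i) (w * cs.simple i)))

/-- Dihedral polynomials. -/
noncomputable def dPoly : ℕ → Polynomial ℤ
  | 0 => 1
  | 1 => X
  | 2 => X ^ 2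
  | (n + 3) => X * dPoly (n + 2) + (X + 1) * dPoly (n + 1)

/-- The degree of a vertex `x` in the Bruhat graph on the vertex set `V`:
the total number of incident edges (incoming plus outgoing). -/
noncomputable def degIn {B W : Type*} [Group W] {M : CoxeterMatrix B}
    (cs : CoxeterSystem M W) (V : Set W) (x : W) : ℕ :=
  Nat.card {y : W // y ∈ V ∧ (BruhatEdge cs x y ∨ BruhatEdge cs y x)}

/-- The Bruhat graph on the vertex set `V` is regular: all vertices have the same degree. -/
def IsRegularOn {B W : Type*} [Group W] {M : CoxeterMatrix B}
    (cs : CoxeterSystem M W) (V : Set W) : Prop :=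
  ∀ x ∈ V, ∀ y ∈ V, degIn cs V x = degIn cs V y

namespace CoxeterMatrix

variable {B : Type*} (M : CoxeterMatrix B)

/-- The simple coroot of index `i` of the standard geometric representation: the linear functional
taking the value `-2 cos (π / M i j)` at the simple root of index `j`. -/
noncomputable def simpleCoroot (i : B) : (B →₀ ℝ) →ₗ[ℝ] ℝ :=
  Finsupp.linearCombination ℝ fun j ↦ -2 * Real.cos (Real.pi / M i j)

theorem simpleCoroot_single (i j : B) :
    M.simpleCoroot i (Finsupp.single j 1) = -2 * Real.cos (Real.pi / M i j) := by
  simp [simpleCoroot]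

theorem simpleCoroot_single_self (i : B) : M.simpleCoroot i (Finsupp.single i 1) = 2 := by
  simp [simpleCoroot_single]

/-- Twice the canonical bilinear form of the standard geometric representation. -/
noncomputable def rootForm : (B →₀ ℝ) →ₗ[ℝ] (B →₀ ℝ) →ₗ[ℝ] ℝ :=
  Finsupp.linearCombination ℝ M.simpleCoroot

theorem rootForm_single (i : B) : M.rootForm (Finsupp.single i 1) = M.simpleCoroot i := by
  simp [rootForm]

theorem rootForm_symm (v w : B →₀ ℝ) : M.rootForm v w = M.rootForm w v := by
  have h : M.rootForm = M.rootForm.flip := by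
    ext i j
    simp [rootForm_single, simpleCoroot_single, M.symmetric i j]
  exact congrArg (fun f ↦ f v w) h

/-- The simple reflection of index `i` in the standard geometric representation. -/
noncomputable def simpleReflection (i : B) : (B →₀ ℝ) ≃ₗ[ℝ] (B →₀ ℝ) :=
  Module.reflection (M.simpleCoroot_single_self i)

theorem simpleReflection_apply (i : B) (v : B →₀ ℝ) :
    M.simpleReflection i v = v - M.rootForm (Finsupp.single i 1) v • Finsupp.single i 1 := by
  rw [rootForm_single, simpleReflection, Module.reflection_apply]

theorem simpleReflection_single (i j : B) :
    M.simpleReflection i (Finsupp.single j 1) =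
      Finsupp.single j 1 + (2 * Real.cos (Real.pi / M i j)) • Finsupp.single i 1 := by
  rw [simpleReflection_apply, rootForm_single, simpleCoroot_single]
  module

theorem simpleReflection_single_self (i : B) :
    M.simpleReflection i (Finsupp.single i 1) = -Finsupp.single i 1 := by
  rw [simpleReflection_apply, rootForm_single, simpleCoroot_single_self]
  module

theorem eval_S_two_mul_cos (φ : ℝ) (k : ℤ) :
    (Polynomial.Chebyshev.S ℝ k).eval (2 * Real.cos φ) * Real.sin φ = Real.sin ((k + 1) * φ) := by
  rw [← Polynomial.Chebyshev.U_real_cos, ← Polynomial.Chebyshev.S_comp_two_mul_X]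
  simp

theorem isLiftable_simpleReflection : M.IsLiftable M.simpleReflection := by
  intro i j
  obtain rfl | hij := eq_or_ne i j
  · rw [M.diagonal, pow_one]
    exact LinearEquiv.ext fun v ↦ Module.involutive_reflection (M.simpleCoroot_single_self i) v
  obtain hm | hm := eq_or_ne (M i j) 0
  · rw [hm, pow_zero]
  have hm1 : M i j ≠ 1 := M.off_diagonal i j hij
  have hsymm : M j i = M i j := M.symmetric j i
  set m := M i j with hm_def
  refine LinearEquiv.ext fun v ↦ ?_
  have ht : 2 * Real.cos (2 * (Real.pi / m)) =
      M.simpleCoroot i (Finsupp.single j 1) * M.simpleCoroot j (Finsupp.single i 1) - 2 := by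
    rw [simpleCoroot_single, simpleCoroot_single, hsymm, ← hm_def, Real.cos_two_mul]
    ring
  have hmθ : (m : ℝ) * (Real.pi / m) = Real.pi := by field_simp
  rw [simpleReflection, simpleReflection, Module.reflection_mul_reflection_pow_apply _ _ m v _ ht]
  rw [LinearEquiv.coe_one, id_eq]
  obtain hm2 | hm2 := eq_or_ne m 2
  · have h0 : M.simpleCoroot i (Finsupp.single j 1) = 0 := by
      rw [simpleCoroot_single, ← hm_def, hm2]; simp
    have h1 : M.simpleCoroot j (Finsupp.single i 1) = 0 := by
      rw [simpleCoroot_single, hsymm, hm2]; simp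
    have hcos : Real.cos (2 * (Real.pi / (2 : ℕ))) = -1 := by
      rw [← Real.cos_pi]; congr 1; push_cast; ring
    rw [hm2, h0, h1, hcos]
    norm_num
    module
  · set φ := 2 * (Real.pi / m) with hφ
    have hm3 : (3 : ℝ) ≤ m := by
      have : 3 ≤ m := by omega
      exact_mod_cast this
    have hφ0 : 0 < Real.sin φ := by
      apply Real.sin_pos_of_pos_of_lt_pi
      · rw [hφ]; positivity
      · rw [hφ, mul_div_assoc', div_lt_iff₀ (by linarith)]
        nlinarith [Real.pi_pos]
    obtain ⟨p, hp | hp⟩ := Nat.even_or_odd' m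
    · have e1 : ((m : ℤ) - 2) / 2 = p - 1 := by omega
      have e2 : ((m : ℤ) - 1) / 2 = p - 1 := by omega
      have h0 : (Polynomial.Chebyshev.S ℝ (p - 1)).eval (2 * Real.cos φ) = 0 := by
        have h := eval_S_two_mul_cos φ (p - 1)
        have e : (((p - 1 : ℤ) : ℝ) + 1) * φ = Real.pi := by
          rw [← hmθ, hφ, hp]; push_cast; ring
        rw [e, Real.sin_pi] at h
        exact (mul_eq_zero.mp h).resolve_right hφ0.ne'
      rw [e1, e2, h0]
      simp
    · have e1 : ((m : ℤ) - 1) / 2 = p := by omega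
      have e2 : ((m : ℤ) - 3) / 2 = p - 1 := by omega
      have e3 : (m : ℤ) / 2 = p := by omega
      have e4 : ((m : ℤ) - 2) / 2 = p - 1 := by omega
      have h0 : (Polynomial.Chebyshev.S ℝ p).eval (2 * Real.cos φ) +
          (Polynomial.Chebyshev.S ℝ (p - 1)).eval (2 * Real.cos φ) = 0 := by
        have h := eval_S_two_mul_cos φ (p - 1)
        have h' := eval_S_two_mul_cos φ p
        have e : (((p : ℤ) : ℝ) + 1) * φ = 2 * Real.pi - (((p - 1 : ℤ) : ℝ) + 1) * φ := by
          rw [← hmθ, hφ, hp]; push_cast; ring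
        rw [e, Real.sin_two_pi_sub, ← h] at h'
        have h'' : ((Polynomial.Chebyshev.S ℝ p).eval (2 * Real.cos φ) +
          (Polynomial.Chebyshev.S ℝ (p - 1)).eval (2 * Real.cos φ)) * Real.sin φ = 0 := by
          linear_combination h'
        exact (mul_eq_zero.mp h'').resolve_right hφ0.ne'
      rw [e1, e2, e3, e4, h0]
      simp

/-- The coefficients of the roots of the rank two root system of type `I₂(m)`. -/
theorem exists_dihedral_coefficients (m : ℕ) (hm1 : m ≠ 1) :
    ∃ a : ℕ → ℝ, a 0 = 0 ∧ a 1 = 1 ∧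
      (∀ k, a (k + 2) = 2 * Real.cos (Real.pi / m) * a (k + 1) - a k) ∧
      ∀ k, (m = 0 ∨ k ≤ m) → 0 ≤ a k := by
  obtain rfl | hm := eq_or_ne m 0
  · refine ⟨fun k ↦ k, by simp, by simp, fun k ↦ ?_, fun k _ ↦ by positivity⟩
    simp only [Nat.cast_zero, div_zero, Real.cos_zero]
    push_cast
    ring
  · have hm2 : (2 : ℝ) ≤ m := by
      have : 2 ≤ m := by omega
      exact_mod_cast this
    have hsin : 0 < Real.sin (Real.pi / m) := by
      apply Real.sin_pos_of_pos_of_lt_pi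
      · positivity
      · rw [div_lt_iff₀ (by linarith)]
        nlinarith [Real.pi_pos]
    refine ⟨fun k ↦ Real.sin (k * (Real.pi / m)) / Real.sin (Real.pi / m), by simp, ?_, fun k ↦ ?_,
      fun k hk ↦ div_nonneg (Real.sin_nonneg_of_nonneg_of_le_pi (by positivity) ?_) hsin.le⟩
    · simp [hsin.ne']
    · dsimp only
      have e2 : ((k + 2 : ℕ) : ℝ) * (Real.pi / m) = (k + 1 : ℕ) * (Real.pi / m) + Real.pi / m := by
        push_cast; ring
      have e0 : (k : ℝ) * (Real.pi / m) = (k + 1 : ℕ) * (Real.pi / m) - Real.pi / m := by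
        push_cast; ring
      rw [e2, e0, Real.sin_add, Real.sin_sub]
      ring
    · have hk' : (k : ℝ) ≤ m := by exact_mod_cast hk.resolve_left hm
      calc (k : ℝ) * (Real.pi / m) ≤ m * (Real.pi / m) := by gcongr
        _ = Real.pi := by field_simp

end CoxeterMatrix

namespace CoxeterSystem

variable {B W : Type*} [Group W] {M : CoxeterMatrix B} (cs : CoxeterSystem M W)

/-- The standard geometric representation of a Coxeter system. -/
noncomputable def geomRep : W →* ((B →₀ ℝ) ≃ₗ[ℝ] (B →₀ ℝ)) :=
  cs.lift ⟨M.simpleReflection, M.isLiftable_simpleReflection⟩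

theorem geomRep_simple (i : B) : cs.geomRep (cs.simple i) = M.simpleReflection i :=
  cs.lift_apply_simple _ i

theorem geomRep_mul_apply (x y : W) (v : B →₀ ℝ) :
    cs.geomRep (x * y) v = cs.geomRep x (cs.geomRep y v) := by
  rw [map_mul, LinearEquiv.mul_apply]

theorem rootForm_geomRep (w : W) (x y : B →₀ ℝ) :
    M.rootForm (cs.geomRep w x) (cs.geomRep w y) = M.rootForm x y := by
  induction w using cs.simple_induction_left generalizing x y with
  | one => simp
  | mul_simple_left w i ih =>
    rw [geomRep_mul_apply, geomRep_mul_apply, geomRep_simple, M.simpleReflection_apply,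
      M.simpleReflection_apply]
    simp only [map_sub, map_smul, LinearMap.sub_apply, LinearMap.smul_apply, smul_eq_mul, ih]
    rw [M.rootForm_symm _ (Finsupp.single i 1), M.rootForm_single, M.simpleCoroot_single_self]
    ring

/-- The action of an alternating word on a simple root. -/
theorem geomRep_alternatingWord (i j : B) (a : ℕ → ℝ) (h0 : a 0 = 0) (h1 : a 1 = 1)
    (ha : ∀ k, a (k + 2) = 2 * Real.cos (Real.pi / M i j) * a (k + 1) - a k) (k : ℕ) :
    cs.geomRep (cs.wordProd (alternatingWord i j k)) (Finsupp.single i 1) =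
      (if Even k then a (k + 1) else a k) • Finsupp.single i 1 +
        (if Even k then a k else a (k + 1)) • Finsupp.single j 1 := by
  induction k with
  | zero => simp [alternatingWord, h0, h1]
  | succ k ih =>
    rw [alternatingWord_succ', cs.wordProd_cons, geomRep_mul_apply, ih, geomRep_simple]
    by_cases hk : Even k
    · have hk' : ¬ Even (k + 1) := by simp [hk, parity_simps]
      simp only [hk, hk', if_true, if_false, map_add, map_smul, M.simpleReflection_single_self, ha]
      rw [M.simpleReflection_single, M.symmetric j i]
      module
    · have hk' : Even (k + 1) := by simp [hk, parity_simps]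
      simp only [hk, hk', if_true, if_false, map_add, map_smul, M.simpleReflection_single_self, ha]
      rw [M.simpleReflection_single]
      module

theorem exists_wordProd_alternatingWord_maximal (w : W) (i j : B) :
    ∃ (v : W) (k : ℕ), w = v * cs.wordProd (alternatingWord i j k) ∧
      cs.length v + k = cs.length w ∧
      ∀ (v' : W) (k' : ℕ), w = v' * cs.wordProd (alternatingWord i j k') →
        cs.length v' + k' = cs.length w → k' ≤ k := by
  classical
  let P : ℕ → Prop := fun k ↦ ∃ v, w = v * cs.wordProd (alternatingWord i j k) ∧
      cs.length v + k = cs.length w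
  have hP0 : P 0 := ⟨w, by simp [alternatingWord], by simp⟩
  obtain ⟨v, hv, hv'⟩ := Nat.findGreatest_spec (Nat.zero_le (cs.length w)) hP0
  exact ⟨v, _, hv, hv', fun v' k' h h' ↦ Nat.le_findGreatest (by omega) ⟨v', h, h'⟩⟩

theorem geomRep_single_nonneg (w : W) (i : B) (h : cs.length w < cs.length (w * cs.simple i)) :
    0 ≤ cs.geomRep w (Finsupp.single i 1) := by
  induction hn : cs.length w using Nat.strong_induction_on generalizing w i with
  | _ n ih =>
  subst hn
  obtain rfl | hw := eq_or_ne w 1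
  · simp
  obtain ⟨j, hj⟩ := cs.exists_rightDescent_of_ne_one hw
  have hij : i ≠ j := by
    rintro rfl
    exact absurd hj (by simpa [IsRightDescent] using h.le)
  obtain ⟨v, k, hwv, hlen, hmax⟩ := cs.exists_wordProd_alternatingWord_maximal w i j
  have hk1 : 1 ≤ k := by
    apply hmax (w * cs.simple j) 1
    · simp [alternatingWord]
    · exact cs.isRightDescent_iff.mp hj
  have hred : cs.length (cs.wordProd (alternatingWord i j k)) = k := by
    apply le_antisymm
    · simpa using cs.length_wordProd_le (alternatingWord i j k)
    · have := cs.length_mul_le v (cs.wordProd (alternatingWord i j k))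
      rw [← hwv] at this
      omega
  have hkm : M i j = 0 ∨ k + 1 ≤ M i j := by
    by_contra! hcon
    obtain ⟨hm, hkm⟩ := hcon
    have hkm' : k = M i j := by
      by_contra hne
      exact cs.not_isReduced_alternatingWord i j hm (m := k) (by omega)
        (by rw [IsReduced, hred, length_alternatingWord])
    have hbraid := cs.wordProd_braidWord_eq i j
    rw [braidWord, braidWord, M.symmetric j i, ← hkm'] at hbraid
    obtain ⟨k, rfl⟩ : ∃ k', k = k' + 1 := ⟨k - 1, by omega⟩
    rw [alternatingWord_succ j i, cs.wordProd_concat] at hbraid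
    have : w * cs.simple i = v * cs.wordProd (alternatingWord i j k) := by
      rw [hwv, hbraid]
      simp [mul_assoc]
    have h3 := cs.length_mul_le v (cs.wordProd (alternatingWord i j k))
    have h4 : cs.length (cs.wordProd (alternatingWord i j k)) ≤ k := by
      simpa using cs.length_wordProd_le (alternatingWord i j k)
    rw [← this] at h3
    omega
  have hnext : cs.length v < cs.length (v * cs.simple (if Even k then j else i)) := by
    by_contra! hle
    have hdesc : cs.IsRightDescent v (if Even k then j else i) :=
      lt_of_le_of_ne hle (cs.length_mul_simple_ne _ _)
    have := hmax (v * cs.simple (if Even k then j else i)) (k + 1)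
      (by rw [alternatingWord_succ', cs.wordProd_cons, hwv]; simp [mul_assoc])
      (by have := cs.isRightDescent_iff.mp hdesc; omega)
    omega
  have hprev : cs.length v < cs.length (v * cs.simple (if Even k then i else j)) := by
    obtain ⟨k, rfl⟩ : ∃ k', k = k' + 1 := ⟨k - 1, by omega⟩
    have hpar : (if Even (k + 1) then i else j) = if Even k then j else i := by
      by_cases hk : Even k <;> simp [hk, parity_simps]
    rw [hpar]
    rw [alternatingWord_succ', cs.wordProd_cons, ← mul_assoc] at hwv
    have h3 := cs.length_mul_le (v * cs.simple (if Even k then j else i))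
      (cs.wordProd (alternatingWord i j k))
    have h4 : cs.length (cs.wordProd (alternatingWord i j k)) ≤ k := by
      simpa using cs.length_wordProd_le (alternatingWord i j k)
    rw [← hwv] at h3
    omega
  have hvi : 0 ≤ cs.geomRep v (Finsupp.single i 1) := by
    refine ih _ (by omega) v i ?_ rfl
    by_cases hk : Even k
    · simpa [hk] using hprev
    · simpa [hk] using hnext
  have hvj : 0 ≤ cs.geomRep v (Finsupp.single j 1) := by
    refine ih _ (by omega) v j ?_ rfl
    by_cases hk : Even k
    · simpa [hk] using hnext
    · simpa [hk] using hprev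
  obtain ⟨a, h0, h1, hrec, hpos⟩ :=
    CoxeterMatrix.exists_dihedral_coefficients (M i j) (M.off_diagonal i j hij)
  have hak : 0 ≤ a k := hpos k (by omega)
  have hak1 : 0 ≤ a (k + 1) := hpos (k + 1) hkm
  rw [hwv, geomRep_mul_apply, cs.geomRep_alternatingWord i j a h0 h1 hrec, map_add, map_smul,
    map_smul]
  by_cases hk : Even k
  · simp only [hk, if_true]
    exact add_nonneg (smul_nonneg hak1 hvi) (smul_nonneg hak hvj)
  · simp only [hk, if_false]
    exact add_nonneg (smul_nonneg hak hvi) (smul_nonneg hak1 hvj)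

theorem geomRep_single_nonpos (w : W) (i : B) (h : cs.length (w * cs.simple i) < cs.length w) :
    cs.geomRep w (Finsupp.single i 1) ≤ 0 := by
  have := cs.geomRep_single_nonneg (w * cs.simple i) i (by simpa using h)
  rw [geomRep_mul_apply, geomRep_simple, M.simpleReflection_single_self, map_neg] at this
  exact neg_nonneg.mp this

theorem geomRep_injective : Function.Injective cs.geomRep := by
  rw [injective_iff_map_eq_one]
  intro w hw
  by_contra hne
  obtain ⟨i, hi⟩ := cs.exists_rightDescent_of_ne_one hne
  have := cs.geomRep_single_nonpos w i hi i
  rw [hw] at this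
  norm_num at this

/-- A positive root whose associated reflection is `t`. -/
structure IsRootOf (t : W) (r : B →₀ ℝ) : Prop where
  nonneg : 0 ≤ r
  norm : M.rootForm r r = 2
  apply : ∀ v, cs.geomRep t v = v - M.rootForm r v • r
  exists_eq : ∃ (w : W) (i : B), r = cs.geomRep w (Finsupp.single i 1)

variable {cs}

theorem IsRootOf.ext {t t' : W} {r : B →₀ ℝ} (h : cs.IsRootOf t r) (h' : cs.IsRootOf t' r) :
    t = t' :=
  cs.geomRep_injective (LinearEquiv.ext fun v ↦ by rw [h.apply, h'.apply])

theorem IsRootOf.apply_self {t : W} {r : B →₀ ℝ} (h : cs.IsRootOf t r) :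
    cs.geomRep t r = -r := by
  rw [h.apply, h.norm]; module

theorem IsRootOf.mul_self {t : W} {r : B →₀ ℝ} (h : cs.IsRootOf t r) : t * t = 1 :=
  cs.geomRep_injective (LinearEquiv.ext fun v ↦ by
    rw [geomRep_mul_apply, h.apply v, map_sub, map_smul, h.apply_self, h.apply v, map_one,
      LinearEquiv.coe_one, id_eq]
    module)

variable (cs)

theorem isRootOf_simple (i : B) : cs.IsRootOf (cs.simple i) (Finsupp.single i 1) where
  nonneg := by simp
  norm := by rw [M.rootForm_single, M.simpleCoroot_single_self]
  apply v := by rw [geomRep_simple, M.simpleReflection_apply]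
  exists_eq := ⟨1, i, by simp⟩

theorem geomRep_conj_apply (w t : W) (r : B →₀ ℝ)
    (h : ∀ v, cs.geomRep t v = v - M.rootForm r v • r) (v : B →₀ ℝ) :
    cs.geomRep (w * t * w⁻¹) v = v - M.rootForm (cs.geomRep w r) v • cs.geomRep w r := by
  have hv : cs.geomRep w (cs.geomRep w⁻¹ v) = v := by rw [← geomRep_mul_apply]; simp
  rw [geomRep_mul_apply, geomRep_mul_apply, h, map_sub, map_smul, hv,
    ← cs.rootForm_geomRep w r, hv]

theorem IsRootOf.conj {t : W} {r : B →₀ ℝ} (h : cs.IsRootOf t r) (w : W)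
    (hw : 0 ≤ cs.geomRep w r) : cs.IsRootOf (w * t * w⁻¹) (cs.geomRep w r) where
  nonneg := hw
  norm := by rw [rootForm_geomRep, h.norm]
  apply := cs.geomRep_conj_apply w t r h.apply
  exists_eq := by
    obtain ⟨x, i, rfl⟩ := h.exists_eq
    exact ⟨w * x, i, by rw [geomRep_mul_apply]⟩

theorem geomRep_single_nonneg_or_nonpos (w : W) (i : B) :
    0 ≤ cs.geomRep w (Finsupp.single i 1) ∨ cs.geomRep w (Finsupp.single i 1) ≤ 0 := by
  obtain h | h := lt_or_gt_of_ne (cs.length_mul_simple_ne w i)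
  · exact Or.inr (cs.geomRep_single_nonpos w i h)
  · exact Or.inl (cs.geomRep_single_nonneg w i h)

theorem IsRootOf.geomRep_nonneg_or_nonpos {t : W} {r : B →₀ ℝ} (h : cs.IsRootOf t r) (w : W) :
    0 ≤ cs.geomRep w r ∨ cs.geomRep w r ≤ 0 := by
  obtain ⟨x, i, rfl⟩ := h.exists_eq
  rw [← geomRep_mul_apply]
  exact cs.geomRep_single_nonneg_or_nonpos (w * x) i

theorem IsReflection.exists_isRootOf {t : W} (ht : cs.IsReflection t) :
    ∃ r, cs.IsRootOf t r := by
  obtain ⟨w, i, rfl⟩ := ht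
  obtain h | h := cs.geomRep_single_nonneg_or_nonpos w i
  · exact ⟨_, (cs.isRootOf_simple i).conj cs w h⟩
  · have h' : 0 ≤ cs.geomRep (w * cs.simple i) (Finsupp.single i 1) := by
      rw [geomRep_mul_apply, geomRep_simple, M.simpleReflection_single_self, map_neg]
      exact neg_nonneg.mpr h
    have := (cs.isRootOf_simple i).conj cs _ h'
    exact ⟨_, by simpa [mul_assoc] using this⟩

/-- A simple reflection permutes the positive roots other than its own root. -/
theorem IsRootOf.eq_simple {t : W} {r : B →₀ ℝ} (h : cs.IsRootOf t r) {i : B}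
    (hi : cs.geomRep (cs.simple i) r ≤ 0) : t = cs.simple i := by
  have hr : r = Finsupp.single i (r i) := by
    ext j
    obtain rfl | hij := eq_or_ne i j
    · simp
    have h1 := hi j
    rw [(cs.isRootOf_simple i).apply] at h1
    have h2 := h.nonneg j
    simp only [Finsupp.coe_sub, Finsupp.coe_smul, Pi.sub_apply, Pi.smul_apply,
      Finsupp.single_eq_of_ne hij.symm, smul_eq_mul, mul_zero, sub_zero, Finsupp.coe_zero,
      Pi.zero_apply] at h1 h2 ⊢
    exact le_antisymm h1 h2
  have hr' : r = r i • Finsupp.single i (1 : ℝ) := by simpa using hr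
  have hnorm := h.norm
  rw [hr'] at hnorm
  simp only [map_smul, LinearMap.smul_apply, smul_eq_mul, (cs.isRootOf_simple i).norm] at hnorm
  have hpos : (0 : ℝ) ≤ r i := h.nonneg i
  have h1 : r i = 1 := by nlinarith
  rw [h1, one_smul] at hr'
  subst hr'
  exact h.ext (cs.isRootOf_simple i)

theorem IsRootOf.length_mul_lt {t : W} {r : B →₀ ℝ} (h : cs.IsRootOf t r) (w : W)
    (hw : cs.geomRep w r ≤ 0) : cs.length (w * t) < cs.length w := by
  induction hn : cs.length w using Nat.strong_induction_on generalizing w t r with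
  | _ n ih =>
  subst hn
  obtain rfl | hw1 := eq_or_ne w 1
  · have h0 : r = 0 := le_antisymm (by simpa using hw) h.nonneg
    have := h.norm
    simp [h0] at this
  obtain ⟨i, hi⟩ := cs.exists_rightDescent_of_ne_one hw1
  have hi' : cs.length (w * cs.simple i) + 1 = cs.length w := cs.isRightDescent_iff.mp hi
  obtain hs | hs := h.geomRep_nonneg_or_nonpos cs (cs.simple i)
  · have := ih _ (by omega) (h.conj cs (cs.simple i) hs) (w * cs.simple i)
      (by rw [← geomRep_mul_apply]; simpa using hw) rfl
    have e : w * cs.simple i * (cs.simple i * t * (cs.simple i)⁻¹) = w * t * cs.simple i := by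
      simp [mul_assoc]
    rw [e] at this
    obtain h2 | h2 := cs.length_mul_simple (w * t) i <;> omega
  · rw [h.eq_simple cs hs]
    exact hi

theorem IsRootOf.lt_length_mul {t : W} {r : B →₀ ℝ} (h : cs.IsRootOf t r) (w : W)
    (hw : 0 ≤ cs.geomRep w r) : cs.length w < cs.length (w * t) := by
  have := h.length_mul_lt cs (w * t) (by
    rw [geomRep_mul_apply, h.apply_self, map_neg]; exact neg_nonpos.mpr hw)
  rwa [mul_assoc, h.mul_self, mul_one] at this

/-- The exchange property in terms of Bruhat edges. -/
theorem bruhatEdge_mul_simple {x y : W} (h : BruhatEdge cs x y) (i : B)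
    (hne : y ≠ x * cs.simple i) : BruhatEdge cs (x * cs.simple i) (y * cs.simple i) := by
  obtain ⟨t, ht, rfl, hlt⟩ := h
  have e : x * t * cs.simple i = x * cs.simple i * (cs.simple i * t * (cs.simple i)⁻¹) := by
    simp [mul_assoc]
  refine ⟨cs.simple i * t * (cs.simple i)⁻¹, ht.conj (cs.simple i), e, ?_⟩
  obtain ⟨r, hr⟩ := ht.exists_isRootOf
  have hx : 0 ≤ cs.geomRep x r := (hr.geomRep_nonneg_or_nonpos cs x).resolve_right
    fun hx ↦ (hr.length_mul_lt cs x hx).not_gt hlt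
  have hs : 0 ≤ cs.geomRep (cs.simple i) r :=
    (hr.geomRep_nonneg_or_nonpos cs (cs.simple i)).resolve_right
      fun hs ↦ hne (by rw [hr.eq_simple cs hs])
  rw [e]
  refine (hr.conj cs (cs.simple i) hs).lt_length_mul cs _ ?_
  rw [← geomRep_mul_apply]
  simpa using hx

end CoxeterSystem

theorem isSquare_or_isSquare_or_isSquare_mul_inv {G : Type*} [CommGroup G] [Finite G]
    (h : ∀ x y : G, x * x = 1 → y * y = 1 → x ≠ 1 → y ≠ 1 → x = y) (x y : G) :
    IsSquare x ∨ IsSquare y ∨ IsSquare (x * y⁻¹) := by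
  let f : G →* G := powMonoidHom 2
  have hf : ∀ z, z ∈ f.range ↔ IsSquare z := fun z ↦ by
    simp only [f, MonoidHom.mem_range, powMonoidHom_apply, pow_two, IsSquare, eq_comm]
  have hker : Nat.card f.ker ≤ 2 := by
    by_contra! hlt
    have := Fintype.ofFinite f.ker
    rw [Nat.card_eq_fintype_card, Fintype.two_lt_card_iff] at hlt
    obtain ⟨a, b, c, hab, hac, hbc⟩ := hlt
    have hmem : ∀ z : f.ker, (z : G) * z = 1 := fun z ↦ by
      have := z.2
      rwa [MonoidHom.mem_ker, powMonoidHom_apply, pow_two] at this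
    have key : ∀ z z' : f.ker, z ≠ z' → z ≠ 1 → z' ≠ 1 → False := fun z z' hz h1 h2 ↦
      hz (Subtype.ext (h z z' (hmem z) (hmem z')
        (by simpa using h1) (by simpa using h2)))
    by_cases ha : a = 1
    · exact key b c hbc (ha ▸ hab.symm) (ha ▸ hac.symm)
    · by_cases hb : b = 1
      · exact key a c hac ha (hb ▸ hbc.symm)
      · exact key a b hab ha hb
  have hindex : f.range.index ≤ 2 := by
    have h1 : Nat.card f.range * f.range.index = Nat.card G := Subgroup.card_mul_index _
    have h2 : Nat.card f.ker * f.ker.index = Nat.card G := Subgroup.card_mul_index _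
    rw [Subgroup.index_ker, ← h1, mul_comm] at h2
    exact (Nat.eq_of_mul_eq_mul_left Nat.card_pos h2) ▸ hker
  have hpos : f.range.index ≠ 0 := Subgroup.index_ne_zero_of_finite
  simp only [← hf]
  by_cases h2 : f.range.index = 2
  · have := Subgroup.mul_mem_iff_of_index_two h2 (a := x) (b := y⁻¹)
    rw [inv_mem_iff] at this
    tauto
  · have : f.range = ⊤ := Subgroup.index_eq_one.mp (by omega)
    simp [this]

theorem mul_eq_inv_mul_of_mem_closure {G : Type*} [Group G] {s a b : G}
    (hs : s * s = 1) (ha : a * a = 1)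
    (hb : b * b = 1) (hcomm : s * a * (s * b) = s * b * (s * a)) {x : G}
    (hx : x ∈ Subgroup.closure {s * a, s * b}) : s * x = x⁻¹ * s := by
  have hs' : s⁻¹ = s := inv_eq_of_mul_eq_one_left hs
  have ha' : a⁻¹ = a := inv_eq_of_mul_eq_one_left ha
  have hb' : b⁻¹ = b := inv_eq_of_mul_eq_one_left hb
  have : IsMulCommutative (Subgroup.closure {s * a, s * b}) :=
    Subgroup.isMulCommutative_closure (by
      rintro x (rfl | rfl) y (rfl | rfl)
      exacts [rfl, hcomm, hcomm.symm, rfl])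
  induction hx using Subgroup.closure_induction with
  | mem x hx =>
    obtain rfl | rfl := hx
    · simp [hs', ha', ← mul_assoc, hs, mul_assoc a s s]
    · simp [hs', hb', ← mul_assoc, hs, mul_assoc b s s]
  | one => simp
  | mul x y hx hy ihx ihy =>
    rw [← mul_assoc, ihx, mul_assoc, ihy, setLike_mul_comm hx hy, mul_inv_rev, mul_assoc]
  | inv x hx ih =>
    rw [inv_inv, ← mul_left_cancel_iff (a := x⁻¹), ← mul_assoc, ← ih]
    simp [mul_assoc]

theorem exists_isConj_mul_mul {G : Type*} [Group G] [Finite G] {s a b : G}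
    (hs : s * s = 1) (ha : a * a = 1)
    (hb : b * b = 1) (hcomm : s * a * (s * b) = s * b * (s * a))
    (h : ∀ x ∈ Subgroup.closure {s * a, s * b}, ∀ y ∈ Subgroup.closure {s * a, s * b},
      x * x = 1 → y * y = 1 → x ≠ 1 → y ≠ 1 → x = y) :
    ∃ z, s * a * b = z * s * z⁻¹ ∨ s * a * b = z * a * z⁻¹ ∨ s * a * b = z * b * z⁻¹ := by
  have hs' : s⁻¹ = s := inv_eq_of_mul_eq_one_left hs
  have hb' : b⁻¹ = b := inv_eq_of_mul_eq_one_left hb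
  set H := Subgroup.closure {s * a, s * b}
  have : IsMulCommutative H := Subgroup.isMulCommutative_closure (by
    rintro x (rfl | rfl) y (rfl | rfl)
    exacts [rfl, hcomm, hcomm.symm, rfl])
  have hinv : ∀ x ∈ H, s * x = x⁻¹ * s := fun x hx ↦
    mul_eq_inv_mul_of_mem_closure hs ha hb hcomm hx
  have hX : s * a ∈ H := Subgroup.subset_closure (by simp)
  have hY : s * b ∈ H := Subgroup.subset_closure (by simp)
  let : CommGroup H :=
    { (inferInstance : Group H) with
      mul_comm := fun x y ↦ Subtype.ext (setLike_mul_comm x.2 y.2) }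
  have key := isSquare_or_isSquare_or_isSquare_mul_inv (G := H)
    (fun x y hx hy hx1 hy1 ↦ Subtype.ext (h x x.2 y y.2 (congrArg Subtype.val hx)
      (congrArg Subtype.val hy) (fun h ↦ hx1 (Subtype.ext h)) (fun h ↦ hy1 (Subtype.ext h))))
    ⟨_, hX⟩ ⟨_, hY⟩
  obtain ⟨⟨z, hzH⟩, hz⟩ | ⟨⟨z, hzH⟩, hz⟩ | ⟨⟨z, hzH⟩, hz⟩ := key
  · have hz' : s * a = z * z := congrArg Subtype.val hz
    have hzb : b * z⁻¹ = z * b := by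
      have h1 : s * b * z⁻¹ = z⁻¹ * (s * b) := setLike_mul_comm hY (inv_mem hzH)
      have h2 : s * z⁻¹ = z * s := by simpa using hinv z⁻¹ (inv_mem hzH)
      calc b * z⁻¹ = s * (s * b * z⁻¹) := by simp [← mul_assoc, hs]
        _ = s * z⁻¹ * s * b := by rw [h1]; simp [mul_assoc]
        _ = z * b := by rw [h2, mul_assoc z, hs, mul_one]
    exact ⟨z, Or.inr (Or.inr (by rw [mul_assoc z, hzb, hz', mul_assoc]))⟩
  · have hz' : s * b = z * z := congrArg Subtype.val hz
    have h1 : s * a * z⁻¹ = z⁻¹ * (s * a) := setLike_mul_comm hX (inv_mem hzH)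
    refine ⟨z⁻¹ * s, Or.inr (Or.inl ?_)⟩
    calc s * a * b = s * a * (s * z) * z := by
          rw [mul_assoc (s * a), mul_assoc s z, ← hz', ← mul_assoc s s, hs, one_mul]
      _ = z⁻¹ * s * a * (z⁻¹ * s)⁻¹ := by
          rw [hinv z hzH, ← mul_assoc, h1, mul_inv_rev, inv_inv, hs']
          simp [mul_assoc]
  · have hz' : s * a * (s * b)⁻¹ = z * z := congrArg Subtype.val hz
    have h2 : s * z⁻¹ = z * s := by simpa using hinv z⁻¹ (inv_mem hzH)
    refine ⟨z, Or.inl ?_⟩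
    rw [mul_assoc z, h2, ← mul_assoc, ← hz', mul_inv_rev, hs', hb']
    simp [mul_assoc, hs]

namespace CoxeterSystem

variable {B W : Type*} [Group W] {M : CoxeterMatrix B} {cs : CoxeterSystem M W}

theorem IsRootOf.eq_of_smul {t t' : W} {r r' : B →₀ ℝ} (h : cs.IsRootOf t r)
    (h' : cs.IsRootOf t' r') {p : ℝ} (hp : r = p • r') : t = t' := by
  have hp2 : p * p = 1 := by
    have := h.norm
    rw [hp] at this
    simp only [map_smul, LinearMap.smul_apply, smul_eq_mul, h'.norm] at this
    linarith
  refine cs.geomRep_injective (LinearEquiv.ext fun v ↦ ?_)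
  rw [h.apply, h'.apply, hp]
  simp only [map_smul, LinearMap.smul_apply, smul_eq_mul, smul_smul]
  rw [mul_right_comm, hp2, one_mul]

theorem IsRootOf.mul_apply_sub_mem {t₁ t₂ : W} {r₁ r₂ : B →₀ ℝ} (h₁ : cs.IsRootOf t₁ r₁)
    (h₂ : cs.IsRootOf t₂ r₂) {P : Submodule ℝ (B →₀ ℝ)} (hr₁ : r₁ ∈ P) (hr₂ : r₂ ∈ P)
    (v : B →₀ ℝ) : cs.geomRep (t₁ * t₂) v - v ∈ P := by
  rw [geomRep_mul_apply, h₁.apply, h₂.apply v, sub_right_comm, sub_sub_cancel_left]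
  exact P.sub_mem (P.neg_mem (P.smul_mem _ hr₂)) (P.smul_mem _ hr₁)

/-- If a product of two reflections moves vectors only by vectors of `P`, and has finite order,
then the roots of the two reflections lie in `P`. -/
theorem IsRootOf.mem_of_mul_apply_sub_mem [Finite W] {t₁ t₂ : W} {r₁ r₂ : B →₀ ℝ}
    (h₁ : cs.IsRootOf t₁ r₁) (h₂ : cs.IsRootOf t₂ r₂) (hne : t₁ ≠ t₂)
    {P : Submodule ℝ (B →₀ ℝ)} (hP : ∀ v, cs.geomRep (t₁ * t₂) v - v ∈ P) : r₁ ∈ P := by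
  set c := M.rootForm r₁ r₂ with hc
  have hc' : M.rootForm r₂ r₁ = c := M.rootForm_symm _ _
  have e₁ : cs.geomRep (t₁ * t₂) r₁ = (c * c - 1) • r₁ - c • r₂ := by
    rw [geomRep_mul_apply, h₂.apply, hc', map_sub, map_smul, h₁.apply_self, h₁.apply r₂, ← hc]
    module
  have e₂ : cs.geomRep (t₁ * t₂) r₂ = c • r₁ - r₂ := by
    rw [geomRep_mul_apply, h₂.apply_self, map_neg, h₁.apply r₂, ← hc]
    module
  by_cases hc4 : c * c = 4
  · exfalso
    have hd : cs.geomRep (t₁ * t₂) ((2 : ℝ) • r₁ - c • r₂) = (2 : ℝ) • r₁ - c • r₂ := by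
      rw [map_sub, map_smul, map_smul, e₁, e₂]
      linear_combination (norm := module) hc4 • r₁
    have hpow : ∀ n : ℕ, cs.geomRep ((t₁ * t₂) ^ n) r₁ =
        r₁ + (n : ℝ) • ((2 : ℝ) • r₁ - c • r₂) := by
      intro n
      induction n with
      | zero => simp
      | succ n ih =>
        rw [pow_succ', geomRep_mul_apply, ih, map_add, map_smul, hd, e₁, hc4]
        push_cast
        module
    have := hpow (orderOf (t₁ * t₂))
    rw [pow_orderOf_eq_one, map_one, LinearEquiv.coe_one, id_eq, left_eq_add, smul_eq_zero] at this
    have h0 := this.resolve_left (by exact_mod_cast (orderOf_pos (t₁ * t₂)).ne')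
    refine hne (h₁.eq_of_smul h₂ (p := c / 2) ?_)
    rw [sub_eq_zero] at h0
    rw [div_eq_inv_mul, mul_smul, ← h0, smul_smul]
    norm_num
  · have h1 := hP r₁
    have h2 := hP r₂
    rw [e₁] at h1
    rw [e₂] at h2
    have h3 := P.sub_mem (P.smul_mem 2 h1) (P.smul_mem c h2)
    have h4 : (2 : ℝ) • ((c * c - 1) • r₁ - c • r₂ - r₁) - c • (c • r₁ - r₂ - r₂) =
        (c * c - 4) • r₁ := by module
    rw [h4] at h3
    exact (P.smul_mem_iff (sub_ne_zero.mpr hc4)).mp h3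

theorem IsRootOf.mem_of_mul_eq_mul [Finite W] {t₁ t₂ t₃ t₄ : W} {r₁ r₂ r₃ : B →₀ ℝ}
    (h₁ : cs.IsRootOf t₁ r₁) (h₂ : cs.IsRootOf t₂ r₂) (h₃ : cs.IsRootOf t₃ r₃)
    (h₄ : cs.IsReflection t₄) (h : t₃ * t₄ = t₁ * t₂) (hne : t₃ ≠ t₄)
    {P : Submodule ℝ (B →₀ ℝ)} (hr₁ : r₁ ∈ P) (hr₂ : r₂ ∈ P) : r₃ ∈ P := by
  obtain ⟨r₄, hr₄⟩ := h₄.exists_isRootOf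
  exact h₃.mem_of_mul_apply_sub_mem hr₄ hne (h ▸ h₁.mul_apply_sub_mem h₂ hr₁ hr₂)

theorem IsRootOf.apply_eq_or_eq_neg {z t : W} {r : B →₀ ℝ} (h : cs.IsRootOf t r)
    (hz : z * t = t * z) : cs.geomRep z r = r ∨ cs.geomRep z r = -r := by
  have hconj := cs.geomRep_conj_apply z t r h.apply r
  rw [hz, mul_inv_cancel_right, h.apply_self] at hconj
  set b := M.rootForm (cs.geomRep z r) r with hb
  have h1 : b • cs.geomRep z r = (2 : ℝ) • r := by
    linear_combination (norm := module) hconj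
  have h2 : b * b = 4 := by
    have := congrArg (fun x ↦ M.rootForm x r) h1
    simp only [map_smul, LinearMap.smul_apply, smul_eq_mul, h.norm, ← hb] at this
    linarith
  have h3 : b = 2 ∨ b = -2 := by
    have : (b - 2) * (b + 2) = 0 := by linarith
    obtain h | h := mul_eq_zero.mp this
    · left; linarith
    · right; linarith
  obtain h3 | h3 := h3 <;> rw [h3] at h1
  · exact Or.inl (smul_right_injective _ two_ne_zero h1)
  · refine Or.inr (smul_right_injective _ (two_ne_zero (α := ℝ)) ?_)
    simp only [smul_neg, ← h1, neg_smul]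
    simp

theorem commute_of_root_eq {s a b : W} {rs ra rb : B →₀ ℝ} (hs : cs.IsRootOf s rs)
    (ha : cs.IsRootOf a ra) (hb : cs.IsRootOf b rb) {p q : ℝ} (h : rs = p • ra + q • rb) :
    s * a * (s * b) = s * b * (s * a) := by
  have key : ∀ v, cs.geomRep (a * s * b) v = cs.geomRep (b * s * a) v := by
    intro v
    have hn := hs.norm
    simp only [geomRep_mul_apply, hs.apply, ha.apply, hb.apply, h, map_sub, map_add, map_smul,
      LinearMap.add_apply, LinearMap.smul_apply, smul_eq_mul, ha.norm, hb.norm,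
      M.rootForm_symm rb ra] at hn ⊢
    generalize M.rootForm ra v = x at *
    generalize M.rootForm rb v = y at *
    generalize M.rootForm ra rb = c at *
    match_scalars
    · ring
    · grind
    · grind
  have := cs.geomRep_injective (LinearEquiv.ext key)
  simp only [mul_assoc] at this ⊢
  rw [this]

theorem IsRootOf.ne_zero {t : W} {r : B →₀ ℝ} (h : cs.IsRootOf t r) : r ≠ 0 := by
  rintro rfl
  simpa using h.norm

theorem apply_sub_mem_of_mem_closure {T : Set W} {P : Submodule ℝ (B →₀ ℝ)}
    (hT : ∀ t ∈ T, ∀ v, cs.geomRep t v - v ∈ P) {z : W} (hz : z ∈ Subgroup.closure T)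
    (v : B →₀ ℝ) : cs.geomRep z v - v ∈ P := by
  induction hz using Subgroup.closure_induction generalizing v with
  | mem t ht => exact hT t ht v
  | one => simp
  | mul x y _ _ ihx ihy =>
    rw [geomRep_mul_apply, ← sub_add_sub_cancel]
    exact P.add_mem (ihx _) (ihy _)
  | inv x _ ih =>
    have := P.neg_mem (ih (cs.geomRep x⁻¹ v))
    rwa [← geomRep_mul_apply, mul_inv_cancel, map_one, LinearEquiv.coe_one, id_eq,
      neg_sub] at this

theorem eq_one_of_apply_eq_self {P : Submodule ℝ (B →₀ ℝ)} {z : W}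
    (h : ∀ v, cs.geomRep z v - v ∈ P) (hP : ∀ v ∈ P, cs.geomRep z v = v) (hz : z * z = 1) :
    z = 1 := by
  refine cs.geomRep_injective (LinearEquiv.ext fun v ↦ ?_)
  have h1 := hP _ (h v)
  rw [map_sub, ← geomRep_mul_apply, hz, map_one, LinearEquiv.coe_one, id_eq] at h1
  rw [map_one, LinearEquiv.coe_one, id_eq]
  refine smul_right_injective _ (two_ne_zero (α := ℝ)) ?_
  linear_combination (norm := module) - h1

/-- If the root of `s` is a combination of the roots of `a` and `b`, then `s * a * b` is a
reflection. -/
theorem isReflection_mul_mul [Finite W] {s a b : W} (hs : cs.IsReflection s)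
    (ha : cs.IsReflection a) (hb : cs.IsReflection b) {rs ra rb : B →₀ ℝ}
    (hrs : cs.IsRootOf s rs) (hra : cs.IsRootOf a ra) (hrb : cs.IsRootOf b rb)
    (hmem : rs ∈ Submodule.span ℝ {ra, rb}) : cs.IsReflection (s * a * b) := by
  obtain ⟨p, q, hpq⟩ := Submodule.mem_span_pair.mp hmem
  obtain rfl | hsa := eq_or_ne s a
  · rwa [hrs.mul_self, one_mul]
  obtain rfl | hsb := eq_or_ne s b
  · simpa [inv_eq_of_mul_eq_one_left hrs.mul_self] using ha.conj s
  have hp : p ≠ 0 := by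
    rintro rfl
    exact hsb (hrs.eq_of_smul hrb (by rw [← hpq, zero_smul, zero_add]))
  have hq : q ≠ 0 := by
    rintro rfl
    exact hsa (hrs.eq_of_smul hra (by rw [← hpq, zero_smul, add_zero]))
  have hcomm := commute_of_root_eq hrs hra hrb hpq.symm
  set H := Subgroup.closure {s * a, s * b} with hH
  set P := Submodule.span ℝ {ra, rb}
  have hraP : ra ∈ P := Submodule.subset_span (by simp)
  have hrbP : rb ∈ P := Submodule.subset_span (by simp)
  have hHP : ∀ z ∈ H, ∀ v, cs.geomRep z v - v ∈ P := fun z hz ↦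
    apply_sub_mem_of_mem_closure (by
      rintro t (rfl | rfl)
      · exact hrs.mul_apply_sub_mem hra hmem hraP
      · exact hrs.mul_apply_sub_mem hrb hmem hrbP) hz
  have : IsMulCommutative H := Subgroup.isMulCommutative_closure (by
    rintro x (rfl | rfl) y (rfl | rfl)
    exacts [rfl, hcomm, hcomm.symm, rfl])
  have hinv := fun z (hz : z ∈ H) ↦
    mul_eq_inv_mul_of_mem_closure hrs.mul_self hra.mul_self hrb.mul_self hcomm hz
  have hinvol : ∀ z ∈ H, z * z = 1 → z ≠ 1 → ∀ v ∈ P, cs.geomRep z v = -v := by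
    intro z hz hzz hz1
    have hz' : z⁻¹ = z := inv_eq_of_mul_eq_one_left hzz
    have hzs : z * s = s * z := by rw [hinv z hz, hz']
    have hcancel : ∀ t, s * t ∈ H → z * t = t * z := fun t ht ↦ by
      have h1 : s * t * z = z * (s * t) := setLike_mul_comm ht hz
      rw [← mul_assoc, hzs, mul_assoc, mul_assoc] at h1
      exact (mul_left_cancel h1).symm
    have hza := hra.apply_eq_or_eq_neg (hcancel a (Subgroup.subset_closure (by simp)))
    have hzb := hrb.apply_eq_or_eq_neg (hcancel b (Subgroup.subset_closure (by simp)))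
    have hzs := hrs.apply_eq_or_eq_neg hzs
    have key : ∀ {r : B →₀ ℝ} {x : ℝ}, r ≠ 0 → x ≠ 0 → (2 : ℝ) • x • r ≠ 0 := fun h1 h2 ↦
      smul_ne_zero two_ne_zero (smul_ne_zero h2 h1)
    have hraP := key hra.ne_zero hp
    have hrbP := key hrb.ne_zero hq
    rw [← hpq, map_add, map_smul, map_smul] at hzs
    have hboth : cs.geomRep z ra = -ra ∧ cs.geomRep z rb = -rb := by
      obtain ha1 | ha1 := hza <;> obtain hb1 | hb1 := hzb <;> rw [ha1, hb1] at hzs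
      · refine absurd (eq_one_of_apply_eq_self (hHP z hz) (fun v hv ↦ ?_) hzz) hz1
        obtain ⟨x, y, rfl⟩ := Submodule.mem_span_pair.mp hv
        rw [map_add, map_smul, map_smul, ha1, hb1]
      · obtain h | h := hzs
        · exact absurd (by linear_combination (norm := module) -h) hrbP
        · exact absurd (by linear_combination (norm := module) h) hraP
      · obtain h | h := hzs
        · exact absurd (by linear_combination (norm := module) -h) hraP
        · exact absurd (by linear_combination (norm := module) h) hrbP
      · exact ⟨ha1, hb1⟩
    intro v hv
    obtain ⟨x, y, rfl⟩ := Submodule.mem_span_pair.mp hv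
    rw [map_add, map_smul, map_smul, hboth.1, hboth.2]
    module
  obtain ⟨z, h | h | h⟩ := exists_isConj_mul_mul hrs.mul_self hra.mul_self hrb.mul_self hcomm (by
    intro x hx y hy hxx hyy hx1 hy1
    have hy' : y⁻¹ = y := inv_eq_of_mul_eq_one_left hyy
    have hxy : y * x = x * y := setLike_mul_comm hy hx
    have : x * y = 1 := by
      refine eq_one_of_apply_eq_self (hHP _ (mul_mem hx hy)) (fun v hv ↦ ?_) ?_
      · rw [geomRep_mul_apply, hinvol y hy hyy hy1 v hv, map_neg, hinvol x hx hxx hx1 v hv,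
          neg_neg]
      · rw [mul_assoc, ← mul_assoc y, hxy, mul_assoc x, hyy, mul_one, hxx]
    rw [eq_inv_of_mul_eq_one_left this, hy'])
  · exact h ▸ hs.conj z
  · exact h ▸ ha.conj z
  · exact h ▸ hb.conj z

/-- The reflection property of a Bruhat configuration with two diamonds. -/
theorem isReflection_mul_inv_mul [Finite W] {s u a b c d w : W} (hs : cs.IsReflection s)
    (hua : cs.IsReflection (u⁻¹ * a)) (hub : cs.IsReflection (u⁻¹ * b))
    (hac : cs.IsReflection (a⁻¹ * c)) (hbc : cs.IsReflection (b⁻¹ * c))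
    (had : cs.IsReflection (a⁻¹ * d)) (hbd : cs.IsReflection (b⁻¹ * d))
    (hcw : w = c * s) (hdw : cs.IsReflection (d⁻¹ * w)) (hab : a ≠ b) (hcd : c ≠ d) :
    cs.IsReflection (s * a⁻¹ * b) := by
  have e : u⁻¹ * a * (u⁻¹ * b) = a⁻¹ * b := by
    rw [← hua.inv]
    simp [mul_assoc]
  obtain ⟨ra, hra⟩ := hua.exists_isRootOf
  obtain ⟨rb, hrb⟩ := hub.exists_isRootOf
  obtain ⟨rc, hrc⟩ := hac.exists_isRootOf
  obtain ⟨rd, hrd⟩ := had.exists_isRootOf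
  obtain ⟨rs, hrs⟩ := hs.exists_isRootOf
  have hraP : ra ∈ Submodule.span ℝ {ra, rb} := Submodule.subset_span (by simp)
  have hrbP : rb ∈ Submodule.span ℝ {ra, rb} := Submodule.subset_span (by simp)
  have hrcP := hra.mem_of_mul_eq_mul hrb hrc hbc (by
    rw [e, ← hbc.inv]; simp [mul_assoc]) (by simpa using hab) hraP hrbP
  have hrdP := hra.mem_of_mul_eq_mul hrb hrd hbd (by
    rw [e, ← hbd.inv]; simp [mul_assoc]) (by simpa using hab) hraP hrbP
  have hrsP := hrc.mem_of_mul_eq_mul hrd hrs hdw (by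
    rw [← hac.inv, ← hdw.inv, hcw]; simp [mul_assoc]) (fun h ↦ hcd (by
    rw [hcw, ← mul_assoc, right_eq_mul, inv_mul_eq_one] at h
    exact h.symm)) hrcP hrdP
  have := isReflection_mul_mul hs hua hub hrs hra hrb hrsP
  rwa [mul_assoc, e, ← mul_assoc] at this

section Bruhat

theorem _root_.BruhatLE.eq_or_length_lt {x y : W} (h : BruhatLE cs x y) :
    x = y ∨ cs.length x < cs.length y := by
  induction h with
  | refl => exact Or.inl rfl
  | tail _ hyz ih =>
    obtain ⟨_, _, _, hlt⟩ := hyz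
    obtain rfl | ih := ih
    · exact Or.inr hlt
    · exact Or.inr (ih.trans hlt)

theorem _root_.BruhatLE.length_le {x y : W} (h : BruhatLE cs x y) :
    cs.length x ≤ cs.length y := by
  obtain rfl | h := h.eq_or_length_lt
  exacts [le_rfl, h.le]

theorem _root_.BruhatLE.eq_of_length_le {x y : W} (h : BruhatLE cs x y)
    (hl : cs.length y ≤ cs.length x) : x = y :=
  h.eq_or_length_lt.resolve_right hl.not_gt

theorem _root_.BruhatLE.bruhatEdge {x y : W} (h : BruhatLE cs x y)
    (hl : cs.length y = cs.length x + 1) : BruhatEdge cs x y := by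
  obtain rfl | ⟨z, hxz, hzy⟩ := h.cases_head
  · omega
  · obtain ⟨_, _, _, hlt⟩ := id hxz
    obtain rfl := BruhatLE.eq_of_length_le hzy (by omega)
    exact hxz

theorem _root_.BruhatEdge.isReflection {x y : W} (h : BruhatEdge cs x y) :
    cs.IsReflection (x⁻¹ * y) := by
  obtain ⟨t, ht, rfl, -⟩ := h
  simpa using ht

theorem bruhatLE_mul_simple_self {x : W} {i : B} (h : cs.length x < cs.length (x * cs.simple i)) :
    BruhatLE cs x (x * cs.simple i) :=
  Relation.ReflTransGen.single ⟨_, cs.isReflection_simple i, rfl, h⟩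

theorem mul_simple_self_bruhatLE {x : W} {i : B}
    (h : cs.length (x * cs.simple i) < cs.length x) : BruhatLE cs (x * cs.simple i) x := by
  simpa using bruhatLE_mul_simple_self (cs := cs) (x := x * cs.simple i) (i := i) (by simpa using h)

theorem _root_.BruhatLE.mul_simple_left {x w : W} (h : BruhatLE cs x w) {i : B}
    (hw : cs.length (w * cs.simple i) < cs.length w) : BruhatLE cs (x * cs.simple i) w := by
  induction h using Relation.ReflTransGen.head_induction_on with
  | refl => exact mul_simple_self_bruhatLE hw
  | @head x y hxy hyw ih =>
    by_cases hy : y = x * cs.simple i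
    · exact hy ▸ hyw
    · exact Relation.ReflTransGen.head (cs.bruhatEdge_mul_simple hxy i hy) ih

theorem _root_.BruhatLE.mul_simple_right {x w : W} (h : BruhatLE cs x w) {i : B}
    (hx : cs.length x < cs.length (x * cs.simple i)) : BruhatLE cs x (w * cs.simple i) := by
  induction h with
  | refl => exact bruhatLE_mul_simple_self hx
  | @tail y z hxy hyz ih =>
    by_cases hz : z = y * cs.simple i
    · rw [hz, simple_mul_simple_cancel_right]
      exact hxy
    · exact Relation.ReflTransGen.tail ih (cs.bruhatEdge_mul_simple hyz i hz)

theorem _root_.BruhatLE.mul_simple_of_descent {x w : W} (h : BruhatLE cs x w) {i : B}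
    (hx : cs.length (x * cs.simple i) < cs.length x) :
    BruhatLE cs (x * cs.simple i) (w * cs.simple i) :=
  BruhatLE.mul_simple_right (Relation.ReflTransGen.trans (mul_simple_self_bruhatLE hx) h)
    (by simpa using hx)

theorem _root_.BruhatLE.mul_simple_of_ascent {x w : W} (h : BruhatLE cs x w) {i : B}
    (hw : cs.length w < cs.length (w * cs.simple i)) :
    BruhatLE cs (x * cs.simple i) (w * cs.simple i) :=
  BruhatLE.mul_simple_left (Relation.ReflTransGen.trans h (bruhatLE_mul_simple_self hw))
    (by simpa using hw)

end Bruhat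

variable (cs) in
/-- The elements of length `k` in the Bruhat interval from `u` to `w`. -/
def intervalLevel (u w : W) (k : ℕ) : Set W :=
  {v | BruhatLE cs u v ∧ BruhatLE cs v w ∧ cs.length v = k}

variable (cs) in
/-- Dihedral Bruhat intervals. -/
structure IsDihedral (u w : W) : Prop where
  le : BruhatLE cs u w
  le_of_lt : ∀ {x y : W} {j k : ℕ}, x ∈ cs.intervalLevel u w j → y ∈ cs.intervalLevel u w k →
    j < k → BruhatLE cs x y
  exists_level : ∀ k, cs.length u < k → k < cs.length w →
    ∃ p q, p ≠ q ∧ cs.intervalLevel u w k = {p, q}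

theorem mem_intervalLevel_left {u w : W} (h : BruhatLE cs u w) :
    u ∈ cs.intervalLevel u w (cs.length u) :=
  ⟨Relation.ReflTransGen.refl, h, rfl⟩

theorem mem_intervalLevel_right {u w : W} (h : BruhatLE cs u w) :
    w ∈ cs.intervalLevel u w (cs.length w) :=
  ⟨h, Relation.ReflTransGen.refl, rfl⟩

theorem eq_left_of_mem_intervalLevel {u w v : W} (h : v ∈ cs.intervalLevel u w (cs.length u)) :
    v = u :=
  (h.1.eq_of_length_le h.2.2.le).symm

theorem eq_right_of_mem_intervalLevel {u w v : W} (h : v ∈ cs.intervalLevel u w (cs.length w)) :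
    v = w :=
  h.2.1.eq_of_length_le h.2.2.ge

theorem mul_simple_mem_intervalLevel {u w v : W} {k : ℕ} (hv : v ∈ cs.intervalLevel u w k) {i : B}
    (hw : cs.length (w * cs.simple i) < cs.length w)
    (hi : cs.length v < cs.length (v * cs.simple i)) :
    v * cs.simple i ∈ cs.intervalLevel u w (k + 1) := by
  refine ⟨hv.1.trans (bruhatLE_mul_simple_self hi), hv.2.1.mul_simple_left hw, ?_⟩
  have := hv.2.2
  obtain h | h := cs.length_mul_simple v i <;> omega

namespace IsDihedral

variable {u w : W}

theorem mono (h : cs.IsDihedral u w) {x y : W} (hux : BruhatLE cs u x) (hxy : BruhatLE cs x y)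
    (hyw : BruhatLE cs y w) : cs.IsDihedral x y where
  le := hxy
  le_of_lt ha hb := h.le_of_lt ⟨hux.trans ha.1, ha.2.1.trans hyw, ha.2.2⟩
    ⟨hux.trans hb.1, hb.2.1.trans hyw, hb.2.2⟩
  exists_level k hk hk' := by
    obtain ⟨p, q, hpq, e⟩ := h.exists_level k (hux.length_le.trans_lt hk)
      (hk'.trans_le hyw.length_le)
    refine ⟨p, q, hpq, e ▸ Set.ext fun v ↦ ⟨fun hv ↦
      ⟨hux.trans hv.1, hv.2.1.trans hyw, hv.2.2⟩, fun hv ↦ ⟨?_, ?_, hv.2.2⟩⟩⟩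
    · exact h.le_of_lt ⟨hux, hxy.trans hyw, rfl⟩ hv hk
    · exact h.le_of_lt hv ⟨hux.trans hxy, hyw, rfl⟩ hk'

theorem exists_mem (h : cs.IsDihedral u w) {k : ℕ} (hk : cs.length u ≤ k)
    (hk' : k ≤ cs.length w) : ∃ v, v ∈ cs.intervalLevel u w k := by
  obtain rfl | hk := hk.eq_or_lt
  · exact ⟨u, mem_intervalLevel_left h.le⟩
  obtain rfl | hk' := hk'.eq_or_lt
  · exact ⟨w, mem_intervalLevel_right h.le⟩
  obtain ⟨p, q, -, e⟩ := h.exists_level k hk hk'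
  exact ⟨p, by simp [e]⟩

theorem exists_ne (h : cs.IsDihedral u w) {k : ℕ} (hk : cs.length u < k)
    (hk' : k < cs.length w) (a : W) : ∃ b ∈ cs.intervalLevel u w k, a ≠ b := by
  obtain ⟨p, q, hpq, e⟩ := h.exists_level k hk hk'
  rw [e]
  by_cases hap : a = p
  · exact ⟨q, by simp, hap ▸ hpq⟩
  · exact ⟨p, by simp, hap⟩

variable {i : B} [Finite W]

theorem descent_of_two_descents (h : cs.IsDihedral u w)
    (hw : cs.length (w * cs.simple i) < cs.length w) {k : ℕ} (hk : cs.length u < k)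
    (hk' : k + 1 < cs.length w) {a b c : W} (ha : a ∈ cs.intervalLevel u w k)
    (hb : b ∈ cs.intervalLevel u w k) (hab : a ≠ b)
    (has : cs.length (a * cs.simple i) < cs.length a)
    (hbs : cs.length (b * cs.simple i) < cs.length b) (hc : c ∈ cs.intervalLevel u w (k + 1)) :
    cs.length (c * cs.simple i) < cs.length c := by
  by_contra! hle
  have hcs := mul_simple_mem_intervalLevel hc hw
    (lt_of_le_of_ne hle (cs.length_mul_simple_ne c i).symm)
  obtain ⟨d, hd, hcd⟩ := h.exists_ne (by omega) hk' c
  obtain ⟨x, hx⟩ := h.exists_mem (k := k - 1) (by omega) (by omega)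
  have edge : ∀ {p q : W} {j : ℕ}, p ∈ cs.intervalLevel u w j →
      q ∈ cs.intervalLevel u w (j + 1) → cs.IsReflection (p⁻¹ * q) := fun hp hq ↦
    ((h.le_of_lt hp hq (Nat.lt_succ_self _)).bruhatEdge (by rw [hp.2.2, hq.2.2])).isReflection
  have hk1 : k - 1 + 1 = k := by omega
  have key := isReflection_mul_inv_mul (cs.isReflection_simple i) (edge hx (hk1 ▸ ha))
    (edge hx (hk1 ▸ hb)) (edge ha hc) (edge hb hc) (edge ha hd) (edge hb hd) rfl (edge hd hcs)
    hab hcd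
  have hle : BruhatLE cs (a * cs.simple i) b :=
    Relation.ReflTransGen.single ⟨_, key, by simp [mul_assoc], by rw [hb.2.2, ← ha.2.2]; exact has⟩
  have hle' := hle.mul_simple_left hbs
  rw [simple_mul_simple_cancel_right] at hle'
  exact hab (hle'.eq_of_length_le (by rw [ha.2.2, hb.2.2]))

theorem descent_unique (h : cs.IsDihedral u w) (hw : cs.length (w * cs.simple i) < cs.length w)
    (hu : BruhatLE cs u (w * cs.simple i)) {k : ℕ} {a b : W} (ha : a ∈ cs.intervalLevel u w k)
    (hb : b ∈ cs.intervalLevel u w k) (has : cs.length (a * cs.simple i) < cs.length a)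
    (hbs : cs.length (b * cs.simple i) < cs.length b) : a = b := by
  obtain rfl | hk := (ha.2.2 ▸ ha.1.length_le : cs.length u ≤ k).eq_or_lt
  · rw [eq_left_of_mem_intervalLevel ha, eq_left_of_mem_intervalLevel hb]
  obtain rfl | hk' := (ha.2.2 ▸ ha.2.1.length_le : k ≤ cs.length w).eq_or_lt
  · rw [eq_right_of_mem_intervalLevel ha, eq_right_of_mem_intervalLevel hb]
  by_contra hab
  have hall : ∀ j, k ≤ j → j < cs.length w → ∀ v ∈ cs.intervalLevel u w j,
      cs.length (v * cs.simple i) < cs.length v := by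
    intro j hj
    induction j, hj using Nat.le_induction with
    | base =>
      intro _ v hv
      obtain ⟨p, q, hpq, e⟩ := h.exists_level k hk hk'
      rw [e] at ha hb hv
      have : v = a ∨ v = b := by
        simp only [Set.mem_insert_iff, Set.mem_singleton_iff] at ha hb hv
        grind
      obtain rfl | rfl := this
      exacts [has, hbs]
    | succ j hj ih =>
      intro hjw v hv
      obtain ⟨p, q, hpq, e⟩ := h.exists_level j (by omega) (by omega)
      have hp : p ∈ cs.intervalLevel u w j := by simp [e]
      have hq : q ∈ cs.intervalLevel u w j := by simp [e]
      exact h.descent_of_two_descents hw (by omega) hjw hp hq hpq (ih (by omega) p hp)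
        (ih (by omega) q hq) hv
  have := hall (cs.length (w * cs.simple i)) (by
    have := cs.length_mul_simple w i
    omega) hw (w * cs.simple i) ⟨hu, mul_simple_self_bruhatLE hw, rfl⟩
  rw [simple_mul_simple_cancel_right] at this
  omega

theorem exists_descent (h : cs.IsDihedral u w) (hw : cs.length (w * cs.simple i) < cs.length w)
    (hu : cs.length (u * cs.simple i) < cs.length u)
    (huw : BruhatLE cs u (w * cs.simple i)) {k : ℕ} (hk : cs.length u ≤ k)
    (hk' : k ≤ cs.length w) :
    ∃ v ∈ cs.intervalLevel u w k, cs.length (v * cs.simple i) < cs.length v := by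
  obtain rfl | hk := hk.eq_or_lt
  · exact ⟨u, mem_intervalLevel_left h.le, hu⟩
  obtain rfl | hk' := hk'.eq_or_lt
  · exact ⟨w, mem_intervalLevel_right h.le, hw⟩
  by_contra! hcon
  have hasc : ∀ v ∈ cs.intervalLevel u w k, cs.length v < cs.length (v * cs.simple i) :=
    fun v hv ↦ lt_of_le_of_ne (hcon v hv) (cs.length_mul_simple_ne v i).symm
  obtain ⟨p, q, hpq, e⟩ := h.exists_level k hk hk'
  have hp : p ∈ cs.intervalLevel u w k := by simp [e]
  have hq : q ∈ cs.intervalLevel u w k := by simp [e]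
  refine hpq (mul_right_cancel (h.descent_unique hw huw
    (mul_simple_mem_intervalLevel hp hw (hasc p hp))
    (mul_simple_mem_intervalLevel hq hw (hasc q hq)) ?_ ?_))
  · simpa using hasc p hp
  · simpa using hasc q hq

theorem exists_ascent (h : cs.IsDihedral u w) (hw : cs.length (w * cs.simple i) < cs.length w)
    (huw : BruhatLE cs u (w * cs.simple i)) {k : ℕ} (hk : cs.length u < k)
    (hk' : k < cs.length w) :
    ∃ v ∈ cs.intervalLevel u w k, cs.length v < cs.length (v * cs.simple i) := by
  by_contra! hcon
  have hdesc : ∀ v ∈ cs.intervalLevel u w k, cs.length (v * cs.simple i) < cs.length v :=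
    fun v hv ↦ lt_of_le_of_ne (hcon v hv) (cs.length_mul_simple_ne v i)
  obtain ⟨p, q, hpq, e⟩ := h.exists_level k hk hk'
  have hp : p ∈ cs.intervalLevel u w k := by simp [e]
  have hq : q ∈ cs.intervalLevel u w k := by simp [e]
  exact hpq (h.descent_unique hw huw hp hq (hdesc p hp) (hdesc q hq))

end IsDihedral

variable {u w : W} {i : B}

theorem mul_simple_lt_iff {x : W} :
    cs.length (x * cs.simple i) < cs.length x ↔ cs.length (x * cs.simple i) + 1 = cs.length x :=
  cs.isRightDescent_iff

theorem mul_simple_mem_of_ascent (hw : cs.length (w * cs.simple i) < cs.length w) {v : W} {k : ℕ}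
    (hv : v ∈ cs.intervalLevel (u * cs.simple i) (w * cs.simple i) k)
    (hi : cs.length v < cs.length (v * cs.simple i)) :
    v * cs.simple i ∈ cs.intervalLevel u w (k + 1) := by
  have h1 := BruhatLE.mul_simple_of_ascent hv.1 hi
  have h2 := BruhatLE.mul_simple_of_ascent hv.2.1 (i := i) (by simpa using hw)
  rw [simple_mul_simple_cancel_right] at h1 h2
  refine ⟨h1, h2, ?_⟩
  have := hv.2.2
  obtain h | h := cs.length_mul_simple v i <;> omega

theorem mul_simple_mem_of_descent (hu : cs.length (u * cs.simple i) < cs.length u) {v : W} {k : ℕ}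
    (hv : v ∈ cs.intervalLevel u w (k + 1))
    (hi : cs.length (v * cs.simple i) < cs.length v) :
    v * cs.simple i ∈ cs.intervalLevel (u * cs.simple i) (w * cs.simple i) k := by
  refine ⟨hv.1.mul_simple_of_descent hu, hv.2.1.mul_simple_of_descent hi, ?_⟩
  have := hv.2.2
  have := mul_simple_lt_iff.mp hi
  omega

theorem mem_of_descent (hw : cs.length (w * cs.simple i) < cs.length w) {v : W} {k : ℕ}
    (hv : v ∈ cs.intervalLevel (u * cs.simple i) (w * cs.simple i) k)
    (hi : cs.length (v * cs.simple i) < cs.length v) :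
    v ∈ cs.intervalLevel u w k := by
  have h1 := hv.1.mul_simple_left hi
  rw [simple_mul_simple_cancel_right] at h1
  exact ⟨h1, hv.2.1.trans (mul_simple_self_bruhatLE hw), hv.2.2⟩

namespace IsDihedral

theorem le_of_ascents (h : cs.IsDihedral u w) (hw : cs.length (w * cs.simple i) < cs.length w) {x y : W} {j k : ℕ}
    (hx : x ∈ cs.intervalLevel (u * cs.simple i) (w * cs.simple i) j)
    (hy : y ∈ cs.intervalLevel (u * cs.simple i) (w * cs.simple i) k) (hjk : j < k)
    (hxi : cs.length x < cs.length (x * cs.simple i))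
    (hyi : cs.length y < cs.length (y * cs.simple i)) : BruhatLE cs x y := by
  have := BruhatLE.mul_simple_of_descent (i := i)
    (h.le_of_lt (mul_simple_mem_of_ascent hw hx hxi) (mul_simple_mem_of_ascent hw hy hyi)
      (Nat.succ_lt_succ hjk)) (by simpa using hxi)
  rwa [simple_mul_simple_cancel_right, simple_mul_simple_cancel_right] at this

theorem mul_simple_of_not_le (h : cs.IsDihedral u w)
    (hw : cs.length (w * cs.simple i) < cs.length w)
    (hu : cs.length (u * cs.simple i) < cs.length u)
    (huw : ¬ BruhatLE cs u (w * cs.simple i)) :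
    cs.IsDihedral (u * cs.simple i) (w * cs.simple i) := by
  have hw' := mul_simple_lt_iff.mp hw
  have hu' := mul_simple_lt_iff.mp hu
  have hdesc : ∀ v k, v ∈ cs.intervalLevel u w k →
      cs.length (v * cs.simple i) < cs.length v := by
    intro v k hv
    by_contra! hle
    exact huw (hv.1.trans (hv.2.1.mul_simple_right
      (lt_of_le_of_ne hle (cs.length_mul_simple_ne v i).symm)))
  have hasc : ∀ v k, v ∈ cs.intervalLevel (u * cs.simple i) (w * cs.simple i) k →
      cs.length v < cs.length (v * cs.simple i) := by
    intro v k hv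
    by_contra! hle
    have := hv.1.mul_simple_left (lt_of_le_of_ne hle (cs.length_mul_simple_ne v i))
    rw [simple_mul_simple_cancel_right] at this
    exact huw (this.trans hv.2.1)
  refine ⟨h.le.mul_simple_of_descent hu, ?_, ?_⟩
  · intro x y j k hx hy hjk
    exact h.le_of_ascents hw hx hy hjk (hasc x j hx) (hasc y k hy)
  · intro k hk hk'
    obtain ⟨p, q, hpq, e⟩ := h.exists_level (k + 1) (by omega) (by omega)
    refine ⟨p * cs.simple i, q * cs.simple i, fun h ↦ hpq (mul_right_cancel h),
      Set.ext fun v ↦ ⟨fun hv ↦ ?_, ?_⟩⟩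
    · have := mul_simple_mem_of_ascent hw hv (hasc v k hv)
      rw [e] at this
      obtain rfl | rfl := this <;> simp
    · have hp : p ∈ cs.intervalLevel u w (k + 1) := by simp [e]
      have hq : q ∈ cs.intervalLevel u w (k + 1) := by simp [e]
      rintro (rfl | rfl)
      · exact mul_simple_mem_of_descent hu hp (hdesc p _ hp)
      · exact mul_simple_mem_of_descent hu hq (hdesc q _ hq)

theorem mul_simple_of_le [Finite W] (h : cs.IsDihedral u w)
    (hw : cs.length (w * cs.simple i) < cs.length w)
    (hu : cs.length (u * cs.simple i) < cs.length u)
    (huw : BruhatLE cs u (w * cs.simple i)) :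
    cs.IsDihedral (u * cs.simple i) (w * cs.simple i) := by
  have hw' := mul_simple_lt_iff.mp hw
  have hu' := mul_simple_lt_iff.mp hu
  refine ⟨h.le.mul_simple_of_descent hu, ?_, ?_⟩
  · intro x y j k hx hy hjk
    obtain hxi | hxi := lt_or_gt_of_ne (cs.length_mul_simple_ne x i) <;>
      obtain hyi | hyi := lt_or_gt_of_ne (cs.length_mul_simple_ne y i)
    · exact h.le_of_lt (mem_of_descent hw hx hxi) (mem_of_descent hw hy hyi) hjk
    · have hx' := mem_of_descent hw hx hxi
      have hy' := mul_simple_mem_of_ascent hw hy hyi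
      have hj := hx'.1.length_le
      have hk := hy.2.1.length_le
      rw [hx'.2.2] at hj
      rw [hy.2.2] at hk
      obtain ⟨v, hv, hvi⟩ := h.exists_ascent hw huw (k := k) (by omega) (by omega)
      have := h.descent_unique hw huw (mul_simple_mem_intervalLevel hv hw hvi) hy'
        (by simpa using hvi) (by simpa using hyi)
      exact mul_right_cancel this ▸ h.le_of_lt hx' hv hjk
    · have hx' := mul_simple_mem_of_ascent hw hx hxi
      have hy' := mem_of_descent hw hy hyi
      refine (bruhatLE_mul_simple_self hxi).trans ?_
      obtain rfl | hlt := (Nat.succ_le_of_lt hjk).eq_or_lt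
      · rw [h.descent_unique hw huw hx' hy' (by simpa using hxi) hyi]
      · exact h.le_of_lt hx' hy' hlt
    · exact h.le_of_ascents hw hx hy hjk hxi hyi
  · intro k hk hk'
    obtain ⟨p, hp, hpi⟩ := h.exists_descent hw hu huw (k := k) (by omega) (by omega)
    obtain ⟨q, hq, hqi⟩ := h.exists_descent hw hu huw (k := k + 1) (by omega) (by omega)
    refine ⟨p, q * cs.simple i, ?_, Set.ext fun v ↦ ⟨fun hv ↦ ?_, ?_⟩⟩
    · rintro rfl
      rw [simple_mul_simple_cancel_right] at hpi
      exact hpi.not_gt hqi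
    · obtain hvi | hvi := lt_or_gt_of_ne (cs.length_mul_simple_ne v i)
      · exact Or.inl (h.descent_unique hw huw (mem_of_descent hw hv hvi) hp hvi hpi)
      · have := h.descent_unique hw huw (mul_simple_mem_of_ascent hw hv hvi) hq
          (by simpa using hvi) hqi
        exact Or.inr (by simp [← this])
    · rintro (rfl | rfl)
      · exact ⟨(mul_simple_self_bruhatLE hu).trans hp.1,
          h.le_of_lt hp ⟨huw, mul_simple_self_bruhatLE hw, rfl⟩ hk', hp.2.2⟩
      · exact mul_simple_mem_of_descent hu hq hqi

theorem mul_simple [Finite W] (h : cs.IsDihedral u w)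
    (hw : cs.length (w * cs.simple i) < cs.length w)
    (hu : cs.length (u * cs.simple i) < cs.length u) :
    cs.IsDihedral (u * cs.simple i) (w * cs.simple i) := by
  by_cases huw : BruhatLE cs u (w * cs.simple i)
  · exact h.mul_simple_of_le hw hu huw
  · exact h.mul_simple_of_not_le hw hu huw

theorem comp_eq_dPoly [Finite W] {R : W → W → Polynomial ℤ} (hR : IsRFamily cs R)
    (h : cs.IsDihedral u w) :
    (R u w).comp (X + 1) = dPoly (cs.length w - cs.length u) := by
  induction hN : cs.length w using Nat.strong_induction_on generalizing u w with
  | _ N ih =>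
  subst hN
  obtain rfl | hlt := h.le.eq_or_length_lt
  · simp [hR.2.1, dPoly]
  have hw1 : w ≠ 1 := by
    rintro rfl
    simp at hlt
  obtain ⟨i, hw⟩ := cs.exists_rightDescent_of_ne_one hw1
  have hw' : cs.length (w * cs.simple i) + 1 = cs.length w := cs.isRightDescent_iff.mp hw
  obtain hu | hu := lt_or_gt_of_ne (cs.length_mul_simple_ne u i)
  · have hu' := mul_simple_lt_iff.mp hu
    rw [(hR.2.2 u w i hw).1 hu, ih _ (by omega) (h.mul_simple hw hu) rfl]
    congr 1
    omega
  · have hui : cs.length (u * cs.simple i) = cs.length u + 1 := by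
      obtain h | h := cs.length_mul_simple u i <;> omega
    have hle : BruhatLE cs u (w * cs.simple i) := h.le.mul_simple_right hu
    have hle' : BruhatLE cs (u * cs.simple i) w := h.le.mul_simple_left hw
    have hD := h.mono Relation.ReflTransGen.refl hle (mul_simple_self_bruhatLE hw)
    rw [(hR.2.2 u w i hw).2 hu]
    simp only [add_comp, mul_comp, sub_comp, X_comp, one_comp, add_sub_cancel_right]
    rw [ih _ (by omega) hD rfl]
    obtain ⟨n, hn⟩ : ∃ n, cs.length w = cs.length u + n + 1 := ⟨cs.length w - cs.length u - 1, by omega⟩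
    have e1 : cs.length (w * cs.simple i) - cs.length u = n := by omega
    have e2 : cs.length w - cs.length u = n + 1 := by omega
    rw [e1, e2]
    by_cases hn2 : 2 ≤ n
    · obtain ⟨n, rfl⟩ := Nat.exists_eq_add_of_le' hn2
      have hle2 : BruhatLE cs (u * cs.simple i) (w * cs.simple i) :=
        h.le_of_lt ⟨bruhatLE_mul_simple_self hu, hle', rfl⟩
          ⟨hle, mul_simple_self_bruhatLE hw, rfl⟩ (by omega)
      rw [ih _ (by omega) (h.mono (bruhatLE_mul_simple_self hu) hle2
        (mul_simple_self_bruhatLE hw)) rfl, dPoly]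
      congr 3
      omega
    · have hR0 : R (u * cs.simple i) (w * cs.simple i) = 0 := by
        refine hR.1 _ _ fun hcon ↦ ?_
        have := mul_right_cancel (hcon.eq_of_length_le (by omega))
        exact hlt.ne (by rw [this])
      rw [hR0, zero_comp, mul_zero, add_zero]
      interval_cases n
      · simp [dPoly]
      · simp [dPoly, pow_two]

end IsDihedral

end CoxeterSystem

theorem stmt13 {B W : Type*} [Group W] [Finite W] {M : CoxeterMatrix B}
    (cs : CoxeterSystem M W)
    (R : W → W → Polynomial ℤ) (hR : IsRFamily cs R)
    (u w : W) (huw : BruhatLE cs u w)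
    (n : ℕ) (hn : cs.length w - cs.length u = n)
    (hdih1 : ∀ x, (BruhatLE cs u x ∧ BruhatLE cs x w) →
      ∀ y, (BruhatLE cs u y ∧ BruhatLE cs y w) →
        (BruhatLE cs x y ↔ x = y ∨ cs.length x < cs.length y))
    (hdih2 : ∀ i : ℕ, 0 < i → i < n →
      Nat.card {v : W // (BruhatLE cs u v ∧ BruhatLE cs v w) ∧
        cs.length v = cs.length u + i} = 2) :
    (R u w).comp (X + 1) = dPoly n := by
  subst hn
  refine CoxeterSystem.IsDihedral.comp_eq_dPoly hR ⟨huw, ?_, ?_⟩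
  · intro x y j k hx hy hjk
    exact (hdih1 x ⟨hx.1, hx.2.1⟩ y ⟨hy.1, hy.2.1⟩).mpr
      (Or.inr (by rw [hx.2.2, hy.2.2]; exact hjk))
  · intro k hk hk'
    have hcard := hdih2 (k - cs.length u) (by omega) (by omega)
    rw [Nat.add_sub_of_le hk.le] at hcard
    have hset : {v | (BruhatLE cs u v ∧ BruhatLE cs v w) ∧ cs.length v = k} =
        cs.intervalLevel u w k := by
      simp only [CoxeterSystem.intervalLevel, and_assoc]
    obtain ⟨p, q, hpq, e⟩ := Set.ncard_eq_two.mp hcard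
    exact ⟨p, q, hpq, hset.symm.trans e⟩
end

section
/- Let (W,S) be a finite Coxeter system and R its family of R-polynomials. For all u ≤ w in Bruhat order with ℓ(u,w) = n ≥ 1, the shifted R-polynomial satisfies q^n ≤ R_{u,w}(q+1) ≤ d_n(q) coefficientwise, and its derivative satisfies n·q^{n−1} ≤ (R_{u,w}(q+1))′ ≤ d_n′(q) coefficientwise, where d_n is the n-th dihedral polynomial. -/
open Polynomial

namespace CoxeterSystem

variable {B W : Type*} [Group W] {M : CoxeterMatrix B} (cs : CoxeterSystem M W)

open Classical in
/-- The action of a simple reflection on pairs `(t, e)`: it conjugates `t`, and flips the sign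
`e` exactly when `t` is that simple reflection. -/
noncomputable def signedConj (i : B) : Equiv.Perm (W × ZMod 2) :=
  Function.Involutive.toPerm
    (fun p => (cs.simple i * p.1 * cs.simple i, p.2 + if p.1 = cs.simple i then 1 else 0)) <| by
      rintro ⟨t, e⟩
      have h : cs.simple i * t * cs.simple i = cs.simple i ↔ t = cs.simple i := by
        rw [mul_eq_right, ← cs.simple_mul_simple_self i, mul_right_inj]
      simp only [h, add_assoc, CharTwo.add_self_eq_zero, add_zero]
      simp [mul_assoc]

open Classical in
theorem signedConj_apply (i : B) (t : W) (e : ZMod 2) :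
    cs.signedConj i (t, e) =
      (cs.simple i * t * cs.simple i, e + if t = cs.simple i then 1 else 0) := rfl

open Classical in
theorem signedConj_mul_pow_apply (i j : B) (k : ℕ) (t : W) (e : ZMod 2) :
    ((cs.signedConj i * cs.signedConj j) ^ k) (t, e) =
      ((cs.simple i * cs.simple j) ^ k * t * ((cs.simple i * cs.simple j) ^ k)⁻¹,
        e + ∑ l ∈ Finset.range (2 * k),
          if cs.simple j * t = (cs.simple i * cs.simple j) ^ l then 1 else 0) := by
  induction k with
  | zero => simp
  | succ k ih =>
    set c := cs.simple i * cs.simple j with hc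
    have hinv : ∀ l : ℕ, (c ^ l)⁻¹ * cs.simple j = cs.simple j * c ^ l := by
      intro l
      have h : cs.simple j * c * (cs.simple j)⁻¹ = c⁻¹ := by simp [hc, mul_assoc]
      rw [← inv_pow, ← h, conj_pow]
      simp [mul_assoc]
    have h₁ : c ^ k * t * (c ^ k)⁻¹ = cs.simple j ↔ cs.simple j * t = c ^ (2 * k) := by
      rw [mul_inv_eq_iff_eq_mul, ← eq_inv_mul_iff_mul_eq, ← mul_assoc, hinv, mul_assoc, ← pow_add,
        ← two_mul, ← inv_mul_eq_iff_eq_mul, inv_simple]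
    have h₂ : cs.simple j * (c ^ k * t * (c ^ k)⁻¹) * cs.simple j = cs.simple i ↔
        cs.simple j * t = c ^ (2 * k + 1) := by
      rw [← eq_mul_inv_iff_mul_eq, ← eq_inv_mul_iff_mul_eq, inv_simple, ← hc,
        mul_inv_eq_iff_eq_mul, ← eq_inv_mul_iff_mul_eq, ← mul_assoc, ← mul_assoc, hinv,
        mul_assoc, mul_assoc, ← pow_succ', ← pow_add, ← inv_mul_eq_iff_eq_mul, inv_simple,
        two_mul, add_assoc]
    have h₃ : cs.simple i * (cs.simple j * (c ^ k * t * (c ^ k)⁻¹) * cs.simple j) * cs.simple i =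
        c ^ (k + 1) * t * (c ^ (k + 1))⁻¹ := by
      rw [pow_succ' c k]
      simp [hc, mul_assoc]
    rw [pow_succ', Equiv.Perm.mul_apply, ih, Equiv.Perm.mul_apply, signedConj_apply,
      signedConj_apply]
    rw [Nat.mul_succ, Finset.sum_range_succ, Finset.sum_range_succ]
    simp only [h₁, h₂, h₃, add_assoc]

theorem isLiftable_signedConj : M.IsLiftable cs.signedConj := by
  classical
  intro i j
  ext1 ⟨t, e⟩
  rw [signedConj_mul_pow_apply, two_mul, Finset.sum_range_add]
  simp only [pow_add, cs.simple_mul_simple_pow, one_mul, inv_one, mul_one, CharTwo.add_self_eq_zero,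
    add_zero, Equiv.Perm.one_apply]

/-- The signed conjugation action of `W` on `W × ZMod 2`. -/
noncomputable def signedConjHom : W →* Equiv.Perm (W × ZMod 2) :=
  cs.lift ⟨cs.signedConj, cs.isLiftable_signedConj⟩

open Classical in
theorem signedConjHom_wordProd (ω : List B) (t : W) (e : ZMod 2) :
    cs.signedConjHom (cs.wordProd ω) (t, e) =
      (cs.wordProd ω * t * (cs.wordProd ω)⁻¹, e + ((cs.rightInvSeq ω).count t : ZMod 2)) := by
  induction ω with
  | nil => simp
  | cons i ω ih =>
    rw [wordProd_cons, map_mul, Equiv.Perm.mul_apply, ih, signedConjHom,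
      lift_apply_simple]
    have h : cs.wordProd ω * t * (cs.wordProd ω)⁻¹ = cs.simple i ↔
        (cs.wordProd ω)⁻¹ * cs.simple i * cs.wordProd ω = t := by
      constructor
      · intro h
        rw [← h]
        group
      · rintro rfl
        group
    rw [signedConj_apply, rightInvSeq, List.count_cons]
    simp only [h, beq_iff_eq, Nat.cast_add, Nat.cast_ite, Nat.cast_one, Nat.cast_zero, add_assoc]
    simp [mul_assoc]

theorem signedConjHom_add (w t : W) (e : ZMod 2) :
    cs.signedConjHom w (t, e) =
      (w * t * w⁻¹, e + (cs.signedConjHom w (t, 0)).2) := by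
  classical
  obtain ⟨ω, rfl⟩ := cs.wordProd_surjective w
  simp [signedConjHom_wordProd]

theorem IsReflection.signedConjHom_self {t : W} (ht : cs.IsReflection t) (e : ZMod 2) :
    cs.signedConjHom t (t, e) = (t, e + 1) := by
  obtain ⟨w, i, rfl⟩ := ht
  set t := w * cs.simple i * w⁻¹ with ht
  have h₁ : cs.signedConjHom w (cs.signedConjHom w⁻¹ (t, e)) = (t, e) := by
    rw [← Equiv.Perm.mul_apply, ← map_mul]
    simp
  have h₂ : w⁻¹ * t * w⁻¹⁻¹ = cs.simple i := by
    rw [ht]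
    group
  rw [cs.signedConjHom_add w⁻¹, h₂, cs.signedConjHom_add w, Prod.mk.injEq] at h₁
  have h₃ : ∀ x : ZMod 2, cs.signedConjHom (cs.simple i) (cs.simple i, x) =
      (cs.simple i, x + 1) := by
    intro x
    rw [signedConjHom, lift_apply_simple]
    simp [signedConj_apply]
  conv_lhs => rw [ht]
  rw [map_mul, map_mul, Equiv.Perm.mul_apply, Equiv.Perm.mul_apply, ← ht,
    cs.signedConjHom_add w⁻¹, h₂, h₃, cs.signedConjHom_add w, ← ht,
    Prod.mk.injEq]
  refine ⟨rfl, ?_⟩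
  rw [add_right_comm, h₁.2]

/-- The strong exchange property: a right inversion of `w` occurs in the right inversion sequence
of every word for `w`. -/
theorem IsRightInversion.mem_rightInvSeq {ω : List B} {t : W}
    (h : cs.IsRightInversion (cs.wordProd ω) t) : t ∈ cs.rightInvSeq ω := by
  classical
  by_contra hmem
  obtain ⟨ω', hω', hprod⟩ := cs.exists_isReduced (cs.wordProd ω * t)
  have h₁ : cs.signedConjHom (cs.wordProd ω * t) (t, 0) =
      (cs.wordProd ω * t * (cs.wordProd ω)⁻¹, 1) := by
    rw [map_mul, Equiv.Perm.mul_apply, h.1.signedConjHom_self,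
      signedConjHom_wordProd, List.count_eq_zero_of_not_mem hmem]
    simp
  rw [hprod, signedConjHom_wordProd, Prod.mk.injEq] at h₁
  have hmem' : t ∈ cs.rightInvSeq ω' := by
    by_contra hmem'
    have h₂ := h₁.2
    rw [List.count_eq_zero_of_not_mem hmem'] at h₂
    simp at h₂
  have h₃ := (cs.isRightInversion_of_mem_rightInvSeq hω' hmem').2
  rw [← hprod, mul_assoc, h.1.mul_self, mul_one] at h₃
  exact lt_asymm h.2 h₃

/-- If `t` is a right inversion of `y` and `s ≠ t` is a simple reflection, then right
multiplication by `s` preserves the relation `ℓ (y * t) < ℓ y`. -/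
theorem IsRightInversion.length_mul_simple_lt {y t : W} {i : B}
    (ht : cs.IsRightInversion y t) (hne : t ≠ cs.simple i) :
    cs.length (y * t * cs.simple i) < cs.length (y * cs.simple i) := by
  obtain ⟨ω, hω, hprod⟩ := cs.exists_isReduced (y * cs.simple i)
  have hy : y = cs.wordProd (ω.concat i) := by simp [wordProd_append, ← hprod, mul_assoc]
  have hmem : t ∈ cs.rightInvSeq (ω.concat i) := by
    rw [hy] at ht
    exact ht.mem_rightInvSeq
  rw [rightInvSeq_concat, List.concat_eq_append, List.mem_append, List.mem_singleton,
    or_iff_left hne, List.mem_map] at hmem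
  obtain ⟨r, hr, rfl⟩ := hmem
  have h := (cs.isRightInversion_of_mem_rightInvSeq hω hr).2
  rw [← hprod] at h
  simpa [mul_assoc] using h

end CoxeterSystem

section Bruhat

variable {B W : Type*} [Group W] {M : CoxeterMatrix B} {cs : CoxeterSystem M W}

theorem BruhatLE.eq_or_length_lt_s15 {u w : W} (h : BruhatLE cs u w) :
    u = w ∨ cs.length u < cs.length w := by
  induction h with
  | refl => exact .inl rfl
  | tail _ hedge ih =>
    obtain ⟨t, -, -, hlt⟩ := hedge
    rcases ih with rfl | ih
    · exact .inr hlt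
    · exact .inr (ih.trans hlt)

theorem bruhatEdge_mul_simple {u : W} {i : B}
    (h : cs.length u < cs.length (u * cs.simple i)) : BruhatEdge cs u (u * cs.simple i) :=
  ⟨cs.simple i, cs.isReflection_simple i, rfl, h⟩

variable (cs) in
/-- The shorter of `u` and `u * s`, for a simple reflection `s`. -/
noncomputable def minMulSimple (i : B) (u : W) : W :=
  if cs.length (u * cs.simple i) < cs.length u then u * cs.simple i else u

theorem minMulSimple_le_self (i : B) (u : W) : BruhatLE cs (minMulSimple cs i u) u := by
  unfold minMulSimple
  split_ifs with h
  · exact .single ⟨cs.simple i, cs.isReflection_simple i, by simp, h⟩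
  · exact .refl

theorem minMulSimple_le_mul_simple (i : B) (u : W) :
    BruhatLE cs (minMulSimple cs i u) (u * cs.simple i) := by
  unfold minMulSimple
  split_ifs with h
  · exact .refl
  · exact .single (bruhatEdge_mul_simple
      (lt_of_le_of_ne (not_lt.mp h) (cs.length_mul_simple_ne u i).symm))

theorem BruhatEdge.minMulSimple_le {u w : W} (h : BruhatEdge cs u w) (i : B) :
    BruhatLE cs (minMulSimple cs i u) (minMulSimple cs i w) := by
  by_cases hw : cs.length (w * cs.simple i) < cs.length w
  · have hmin : minMulSimple cs i w = w * cs.simple i := if_pos hw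
    rw [hmin]
    obtain ⟨t, ht, hwu, hlt⟩ := h
    have hu : u = w * t := by rw [hwu, mul_assoc, ht.mul_self, mul_one]
    by_cases hne : t = cs.simple i
    · rw [← hne, ← hu]
      exact minMulSimple_le_self i u
    · have hlt' := CoxeterSystem.IsRightInversion.length_mul_simple_lt cs
        ⟨ht, hu ▸ hlt⟩ hne
      rw [← hu] at hlt'
      refine (minMulSimple_le_mul_simple i u).tail
        ⟨cs.simple i * t * (cs.simple i)⁻¹, ht.conj _, ?_, hlt'⟩
      simp [hwu, mul_assoc]
  · have hmin : minMulSimple cs i w = w := if_neg hw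
    rw [hmin]
    exact (minMulSimple_le_self i u).tail h

/-- The lifting property of Bruhat order. -/
theorem BruhatLE.minMulSimple_le {u w : W} (h : BruhatLE cs u w) (i : B) :
    BruhatLE cs (minMulSimple cs i u) (minMulSimple cs i w) := by
  induction h with
  | refl => exact .refl
  | tail _ hedge ih => exact ih.trans (hedge.minMulSimple_le i)

end Bruhat

/-- Coefficientwise inequality of integer polynomials. -/
def CoeffLE (p q : ℤ[X]) : Prop := ∀ m, p.coeff m ≤ q.coeff m

namespace CoeffLE

theorem refl (p : ℤ[X]) : CoeffLE p p := fun _ => le_rfl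

theorem add {p q p' q' : ℤ[X]} (h : CoeffLE p q) (h' : CoeffLE p' q') :
    CoeffLE (p + p') (q + q') := fun m => by
  simpa only [coeff_add] using add_le_add (h m) (h' m)

theorem X_mul {p q : ℤ[X]} (h : CoeffLE p q) : CoeffLE (X * p) (X * q) := fun m => by
  cases m with
  | zero => simp
  | succ m => simpa only [coeff_X_mul] using h m

theorem X_add_one_mul {p q : ℤ[X]} (h : CoeffLE p q) :
    CoeffLE ((X + 1) * p) ((X + 1) * q) := by
  simpa only [add_mul, one_mul] using h.X_mul.add h

theorem derivative {p q : ℤ[X]} (h : CoeffLE p q) :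
    CoeffLE (Polynomial.derivative p) (Polynomial.derivative q) := fun m => by
  simpa only [coeff_derivative] using mul_le_mul_of_nonneg_right (h (m + 1)) (by positivity)

end CoeffLE

theorem coeffLE_zero_dPoly (n : ℕ) : CoeffLE 0 (dPoly n) := by
  induction n using dPoly.induct with
  | case1 => intro m; simp [dPoly, coeff_one]; split_ifs <;> simp
  | case2 => intro m; simp [dPoly, coeff_X]; split_ifs <;> simp
  | case3 => intro m; simp [dPoly, coeff_X_pow]; split_ifs <;> simp
  | case4 n ih₁ ih₂ =>
    rw [dPoly]
    simpa using ih₁.X_mul.add ih₂.X_add_one_mul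

section RPolynomial

variable {B W : Type*} [Group W] {M : CoxeterMatrix B} {cs : CoxeterSystem M W}
  {R : W → W → ℤ[X]}

theorem IsRFamily.eq_zero_of_length_le (hR : IsRFamily cs R) {u w : W}
    (hle : cs.length w ≤ cs.length u) (hne : u ≠ w) : R u w = 0 := by
  refine hR.1 u w fun h => ?_
  rcases h.eq_or_length_lt_s15 with h | h
  · exact hne h
  · exact absurd h hle.not_gt

theorem IsRFamily.shift_bounds (hR : IsRFamily cs R) (n : ℕ) (u w : W)
    (hn : cs.length w = cs.length u + n) :
    CoeffLE 0 ((R u w).comp (X + 1)) ∧ CoeffLE ((R u w).comp (X + 1)) (dPoly n) ∧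
      (BruhatLE cs u w → CoeffLE (X ^ n) ((R u w).comp (X + 1))) := by
  induction hk : cs.length w generalizing n u w with
  | zero =>
    obtain rfl : n = 0 := by omega
    have hw : w = 1 := cs.length_eq_zero_iff.mp hk
    have hu : u = 1 := cs.length_eq_zero_iff.mp (by omega)
    have h0 := coeffLE_zero_dPoly 0
    rw [hw, hu, hR.2.1, one_comp, pow_zero]
    exact ⟨h0, .refl 1, fun _ => .refl 1⟩
  | succ k ih =>
    have hw1 : w ≠ 1 := by
      rintro rfl
      simp at hk
    obtain ⟨i, hi⟩ := cs.exists_rightDescent_of_ne_one hw1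
    have hwi := cs.isRightDescent_iff.mp hi
    have hlift : BruhatLE cs u w → BruhatLE cs (minMulSimple cs i u) (w * cs.simple i) := by
      intro h
      have hmin : minMulSimple cs i w = w * cs.simple i := if_pos hi
      exact hmin ▸ h.minMulSimple_le i
    rcases cs.length_mul_simple u i with hu | hu
    · have hmin : minMulSimple cs i u = u := if_neg (by omega)
      rw [hmin] at hlift
      have hne : u ≠ w := by
        rintro rfl
        omega
      have hrec : (R u w).comp (X + 1) = X * (R u (w * cs.simple i)).comp (X + 1)
          + (X + 1) * (R (u * cs.simple i) (w * cs.simple i)).comp (X + 1) := by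
        rw [(hR.2.2 u w i hi).2 (by omega)]
        simp
      match n with
      | 0 =>
        have h₁ : R u w = 0 := hR.eq_zero_of_length_le (by omega) hne
        rw [h₁, zero_comp]
        refine ⟨.refl 0, coeffLE_zero_dPoly 0, fun h => ?_⟩
        rcases h.eq_or_length_lt_s15 with h | h
        · exact absurd h hne
        · omega
      | 1 =>
        have h₁ : R (u * cs.simple i) (w * cs.simple i) = 0 :=
          hR.eq_zero_of_length_le (by omega) fun h => hne (mul_right_cancel h)
        obtain ⟨ha, hb, hc⟩ := ih 0 u (w * cs.simple i) (by omega) (by omega)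
        rw [hrec, h₁, zero_comp, mul_zero, add_zero]
        exact ⟨by simpa using ha.X_mul, by simpa [dPoly] using hb.X_mul,
          fun h => by simpa using (hc (hlift h)).X_mul⟩
      | 2 =>
        have h₁ : R (u * cs.simple i) (w * cs.simple i) = 0 :=
          hR.eq_zero_of_length_le (by omega) fun h => hne (mul_right_cancel h)
        obtain ⟨ha, hb, hc⟩ := ih 1 u (w * cs.simple i) (by omega) (by omega)
        rw [hrec, h₁, zero_comp, mul_zero, add_zero]
        exact ⟨by simpa using ha.X_mul, by simpa [dPoly, pow_two] using hb.X_mul,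
          fun h => by simpa [pow_two] using (hc (hlift h)).X_mul⟩
      | n + 3 =>
        obtain ⟨ha, hb, hc⟩ := ih (n + 2) u (w * cs.simple i) (by omega) (by omega)
        obtain ⟨ha', hb', -⟩ :=
          ih (n + 1) (u * cs.simple i) (w * cs.simple i) (by omega) (by omega)
        rw [hrec, dPoly]
        refine ⟨by simpa using ha.X_mul.add ha'.X_add_one_mul, hb.X_mul.add hb'.X_add_one_mul,
          fun h => ?_⟩
        simpa [pow_succ' X (n + 2)] using (hc (hlift h)).X_mul.add ha'.X_add_one_mul
    · have hmin : minMulSimple cs i u = u * cs.simple i := if_pos (by omega)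
      rw [hmin] at hlift
      obtain ⟨ha, hb, hc⟩ := ih n (u * cs.simple i) (w * cs.simple i) (by omega) (by omega)
      rw [(hR.2.2 u w i hi).1 (by omega)]
      exact ⟨ha, hb, fun h => hc (hlift h)⟩

end RPolynomial

theorem stmt15 {B W : Type*} [Group W] [Finite W] {M : CoxeterMatrix B}
    (cs : CoxeterSystem M W)
    (R : W → W → Polynomial ℤ) (hR : IsRFamily cs R)
    (u w : W) (huw : BruhatLE cs u w)
    (n : ℕ) (hn : cs.length w - cs.length u = n) (hn1 : 1 ≤ n) :
    (∀ m : ℕ, ((X : Polynomial ℤ) ^ n).coeff m ≤ ((R u w).comp (X + 1)).coeff m) ∧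
    (∀ m : ℕ, ((R u w).comp (X + 1)).coeff m ≤ (dPoly n).coeff m) ∧
    (∀ m : ℕ, ((n : Polynomial ℤ) * X ^ (n - 1)).coeff m
        ≤ (Polynomial.derivative ((R u w).comp (X + 1))).coeff m) ∧
    (∀ m : ℕ, (Polynomial.derivative ((R u w).comp (X + 1))).coeff m
        ≤ (Polynomial.derivative (dPoly n)).coeff m) := by
  obtain ⟨-, hupper, hlower⟩ := hR.shift_bounds n u w (by omega)
  refine ⟨hlower huw, hupper, ?_, hupper.derivative⟩
  simpa only [CoeffLE, derivative_X_pow, map_natCast] using (hlower huw).derivative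
end
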